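/- arXiv:1912.00453 — 2 statements merged into one kernel-verified Lean document; each statement's English description precedes it below -/
import Mathlib

section
/- Assume k > 2. In the generic band situation there exists a polynomial φ̃_1* ∈ R such that φ̃_1 · φ̃_1* = a_{k+1,1} · φ̃_2^k + Σ_{i=1}^{k} c̃_i · (a_{k+1,2}⋯a_{k+1,n})^{i−1} · φ̃_{n+1}^i · φ̃_2^{k−i}. -/
open Matrix Finset

noncomputable section

/-- The determinant of the minor of the `ℕ`-indexed (0-based) matrix `Φ` on the 1-based
row/column range `[i, M]`; for `i = M + 1` this is the determinant of the empty matrix, `1`. -/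
def sminor {α : Type*} [CommRing α] (Φ : ℕ → ℕ → α) (i M : ℕ) : α :=
  (Matrix.of fun r c : Fin (M + 1 - i) => Φ (i - 1 + (r : ℕ)) (i - 1 + (c : ℕ))).det

/-- Package an `ℕ`-indexed (0-based) family of entries as an `n × n` matrix. -/
def toSq {α : Type*} (n : ℕ) (f : ℕ → ℕ → α) : Matrix (Fin n) (Fin n) α :=
  Matrix.of fun i j => f (i : ℕ) (j : ℕ)

/-- The core `Φ` of a staircase pair `(X, Y)` of `n × n` matrices with parameters
`a = k + b`; it is an `N × N` matrix, `N = (k-1)*n + b`, given here as a (0-based)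
`ℕ`-indexed family of entries.  For `1 ≤ j ≤ k-1` (1-based), the block rows
`(j-1)(n-1)+1 .. j(n-1)` carry `Y_{[2,n]}` in columns `(j-1)n+1 .. jn` and (for `j ≥ 2`)
`X_{[2,n]}` in columns `(j-2)n+1 .. (j-1)n`; the last `a - 1` rows carry `X_{[2,a]}` in
columns `(k-2)n+1 .. (k-1)n` and `Y_{[2,a]}^{[1,b]}` in columns `(k-1)n+1 .. N`. -/
def stairCore {α : Type*} [Zero α] (n k : ℕ) (Xf Yf : ℕ → ℕ → α) : ℕ → ℕ → α := fun r c =>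
  if r < (k - 1) * (n - 1) then
    if r / (n - 1) * n ≤ c ∧ c < r / (n - 1) * n + n then
      Yf (r % (n - 1) + 1) (c - r / (n - 1) * n)
    else if 1 ≤ r / (n - 1) ∧ (r / (n - 1) - 1) * n ≤ c ∧ c < r / (n - 1) * n then
      Xf (r % (n - 1) + 1) (c - (r / (n - 1) - 1) * n)
    else 0
  else
    if (k - 2) * n ≤ c ∧ c < (k - 1) * n then
      Xf (r - (k - 1) * (n - 1) + 1) (c - (k - 2) * n)
    else if (k - 1) * n ≤ c then
      Yf (r - (k - 1) * (n - 1) + 1) (c - (k - 1) * n)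
    else 0

/-- `det Ȳ`: determinant of the submatrix of `Y` on rows and columns `2..n` (1-based). -/
def detYbar {α : Type*} [CommRing α] (n : ℕ) (Yf : ℕ → ℕ → α) : α :=
  (Matrix.of fun i j : Fin (n - 1) => Yf ((i : ℕ) + 1) ((j : ℕ) + 1)).det

/-- Determinant of the minor of `Y` on rows `{1, 3, 4, …, n}` and columns `{2, …, n}`
(1-based). -/
def detYgamma {α : Type*} [CommRing α] (n : ℕ) (Yf : ℕ → ℕ → α) : α :=
  (Matrix.of fun i j : Fin (n - 1) =>
    Yf (if (i : ℕ) = 0 then 0 else (i : ℕ) + 1) ((j : ℕ) + 1)).det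

/-- `det (λ Y + μ X)` as a polynomial in the two variables `λ = X 0`, `μ = X 1`. -/
def detLM {α : Type*} [CommRing α] (n : ℕ) (Xf Yf : ℕ → ℕ → α) :
    MvPolynomial (Fin 2) α :=
  Matrix.det
    (((MvPolynomial.X 0 : MvPolynomial (Fin 2) α) • (toSq n Yf).map (fun p => MvPolynomial.C p)
      + (MvPolynomial.X 1 : MvPolynomial (Fin 2) α) • (toSq n Xf).map (fun p => MvPolynomial.C p)
      : Matrix (Fin n) (Fin n) (MvPolynomial (Fin 2) α)))

/-- The block `Y2`: submatrix of `Y` on rows `k+1 .. k+b` and columns `1 .. b` (1-based). -/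
def blockY2 (n k b : ℕ) (h : k + b ≤ n) (Y : Matrix (Fin n) (Fin n) ℂ) :
    Matrix (Fin b) (Fin b) ℂ :=
  Matrix.of fun i j => Y ⟨k + (i : ℕ), by have := i.isLt; omega⟩ (Fin.castLE (by omega) j)

/-- The `k × k` matrix `U = W11 - Y1 Y2⁻¹ W21` attached to a staircase pair `(X, Y)`,
where `[[W11, W12], [W21, W22]]` is the `a × a` leading block of `X Y⁻¹` (`W11` of size
`k × k`) and `[Y1; Y2]` is the submatrix of `Y` on rows `1..a`, columns `1..b`. -/
def blockU (n k b : ℕ) (h : k + b ≤ n) (X Y : Matrix (Fin n) (Fin n) ℂ) :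
    Matrix (Fin k) (Fin k) ℂ :=
  (Matrix.of fun i j : Fin k =>
      (X * Y⁻¹) (Fin.castLE (by omega) i) (Fin.castLE (by omega) j))
    - (Matrix.of fun (i : Fin k) (j : Fin b) =>
          Y (Fin.castLE (by omega) i) (Fin.castLE (by omega) j))
      * (blockY2 n k b h Y)⁻¹
      * (Matrix.of fun (i : Fin b) (j : Fin k) =>
          (X * Y⁻¹) ⟨k + (i : ℕ), by have := i.isLt; omega⟩ (Fin.castLE (by omega) j))

/-- The standard basis vector `e_{m+1}` (so `basisVec k 0 = e_1`, `basisVec k 1 = e_2`). -/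
def basisVec (k m : ℕ) : Fin k → ℂ := fun i => if (i : ℕ) = m then 1 else 0

/-- The vector `v_γ = U (e_2 + γ e_1)`, with `γ` the ratio of the minor of `Y` on rows
`{1,3,…,n}`, columns `{2,…,n}` by `det Ȳ`. -/
def vGamma (n k b : ℕ) (h : k + b ≤ n) (X Y : ℕ → ℕ → ℂ) : Fin k → ℂ :=
  (blockU n k b h (toSq n X) (toSq n Y)).mulVec
    (basisVec k 1 + (detYgamma n Y / detYbar n Y) • basisVec k 0)

/-- The coefficient ring for the generic staircase pair: polynomials over `ℂ` in the
variables `x_{ij}` (tagged `true`) and `y_{ij}` (tagged `false`). -/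
abbrev Rgen : Type := MvPolynomial (Bool × ℕ × ℕ) ℂ

/-- The generic staircase matrix `X` (0-based): `x_{ij}` for `i < a`, `b ≤ j < n`, else `0`. -/
def genX (n a b : ℕ) : ℕ → ℕ → Rgen := fun i j =>
  if i < a ∧ b ≤ j ∧ j < n then MvPolynomial.X (true, i, j) else 0

/-- The generic staircase matrix `Y` (0-based): `y_{ij}` except in the zero block
(`i ≥ a`, `j < b`). -/
def genY (n a b : ℕ) : ℕ → ℕ → Rgen := fun i j =>
  if i < n ∧ j < n ∧ ¬(a ≤ i ∧ j < b) then MvPolynomial.X (false, i, j) else 0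

/-- The coefficient ring for the generic band pair: polynomials over `ℂ` in variables
`a_{ij}`. -/
abbrev Rband : Type := MvPolynomial (ℕ × ℕ) ℂ

/-- The generic band entries `a_{ij}` (1-based). -/
def genA : ℕ → ℕ → Rband := fun i j => MvPolynomial.X (i, j)

/-- The band matrix `X` (0-based indices) built from the entries `a_{ij}` (1-based):
`X_{i, n-k+i-1+s} = a_{s,i}` for `1 ≤ i ≤ k`, `1 ≤ s ≤ k+1-i` (1-based). -/
def bandX {α : Type*} [Zero α] (n k : ℕ) (a : ℕ → ℕ → α) : ℕ → ℕ → α := fun i j =>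
  if i < k ∧ n - k + i ≤ j ∧ j < n then a (j + k + 1 - n - i) (i + 1) else 0

/-- The band matrix `Y` (0-based indices) built from the entries `a_{ij}` (1-based):
`Y_{ij} = a_{k+1-i+j, i}` for `max(1, i-k) ≤ j ≤ i` (1-based), `0` otherwise. -/
def bandY {α : Type*} [Zero α] (n k : ℕ) (a : ℕ → ℕ → α) : ℕ → ℕ → α := fun i j =>
  if j ≤ i ∧ i ≤ j + k ∧ i < n then a (k + 1 + j - i) (i + 1) else 0

/-- Top-left `k × k` block of `X * Y⁻¹`. -/
def bandUblock (n k : ℕ) (h : k ≤ n) (Xm Ym : Matrix (Fin n) (Fin n) ℂ) :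
    Matrix (Fin k) (Fin k) ℂ :=
  Matrix.of fun i j => (Xm * Ym⁻¹) (Fin.castLE h i) (Fin.castLE h j)

/-- `K(A;u) = [u, Au, …, A^{k-1}u]`. -/
def Kmat (k : ℕ) (A : Matrix (Fin k) (Fin k) ℂ) (u : Fin k → ℂ) :
    Matrix (Fin k) (Fin k) ℂ :=
  Matrix.of fun i j => (A ^ (j : ℕ)).mulVec u i

/-- `K1(A;u,v) = [v, u, Au, …, A^{k-2}u]`. -/
def K1mat (k : ℕ) (A : Matrix (Fin k) (Fin k) ℂ) (u v : Fin k → ℂ) :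
    Matrix (Fin k) (Fin k) ℂ :=
  Matrix.of fun i j => if (j : ℕ) = 0 then v i else (A ^ ((j : ℕ) - 1)).mulVec u i

/-- `K2(A;u,v) = [Av, u, Au, …, A^{k-2}u]`. -/
def K2mat (k : ℕ) (A : Matrix (Fin k) (Fin k) ℂ) (u v : Fin k → ℂ) :
    Matrix (Fin k) (Fin k) ℂ :=
  Matrix.of fun i j => if (j : ℕ) = 0 then A.mulVec v i else (A ^ ((j : ℕ) - 1)).mulVec u i

/-- `w`: the last row of the classical adjoint of `K1(A;u,v)`. -/
def wRow (k : ℕ) (A : Matrix (Fin k) (Fin k) ℂ) (u v : Fin k → ℂ) : Fin k → ℂ :=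
  fun j => (K1mat k A u v).adjugate ⟨k - 1, by have := j.isLt; omega⟩ j

/-- `K*(A;u,v)`: the matrix with rows `w, wA, …, wA^{k-1}`. -/
def Kstar (k : ℕ) (A : Matrix (Fin k) (Fin k) ℂ) (u v : Fin k → ℂ) :
    Matrix (Fin k) (Fin k) ℂ :=
  Matrix.of fun i j => Matrix.vecMul (wRow k A u v) (A ^ (i : ℕ)) j

/-- Extend a `k × k` matrix by zero to an `ℕ`-indexed family of entries. -/
def extMat {α : Type*} [Zero α] (k : ℕ) (M : Matrix (Fin k) (Fin k) α) : ℕ → ℕ → α :=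
  fun i j => if h : i < k ∧ j < k then M ⟨i, h.1⟩ ⟨j, h.2⟩ else 0

/-- The matrix with columns `e₀, b, V b, …, V ^ (k - 2) b`. -/
def krylovMat {A : Type*} [CommRing A] {k : ℕ} (V : Matrix (Fin k) (Fin k) A) (b : Fin k → A) :
    Matrix (Fin k) (Fin k) A :=
  Matrix.of fun i j =>
    if (j : ℕ) = 0 then (if (i : ℕ) = 0 then 1 else 0) else ((V ^ ((j : ℕ) - 1)) *ᵥ b) i

/-- The matrix with rows `f, f V, …, f V ^ (k - 1)`. -/
def rowOrbit {A : Type*} [CommRing A] {k : ℕ} (V : Matrix (Fin k) (Fin k) A) (f : Fin k → A) :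
    Matrix (Fin k) (Fin k) A :=
  Matrix.of fun i => f ᵥ* V ^ (i : ℕ)

theorem rowOrbit_mul_of_commute {A : Type*} [CommRing A] {k : ℕ} {V B : Matrix (Fin k) (Fin k) A}
    (h : Commute V B) (f : Fin k → A) : rowOrbit V f * B = rowOrbit V (f ᵥ* B) := by
  funext i
  have : (rowOrbit V f * B) i = (f ᵥ* V ^ (i : ℕ)) ᵥ* B := rfl
  rw [this, Matrix.vecMul_vecMul, (h.pow_left _).eq, ← Matrix.vecMul_vecMul]
  rfl

theorem rowOrbit_smul {A : Type*} [CommRing A] {k : ℕ} (V : Matrix (Fin k) (Fin k) A) (s : A)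
    (f : Fin k → A) : rowOrbit V (s • f) = s • rowOrbit V f := by
  ext i j
  simp [rowOrbit, Matrix.smul_vecMul]

theorem krylovMat_col_zero {A : Type*} [CommRing A] {k : ℕ} (V : Matrix (Fin (k + 1)) (Fin (k + 1)) A)
    (b : Fin (k + 1) → A) : (krylovMat V b).col 0 = Pi.single 0 1 := by
  ext i
  rw [Pi.single_apply]
  simp only [krylovMat, Matrix.col_apply, Matrix.of_apply, Fin.val_zero, if_true, Fin.ext_iff]

theorem krylovMat_col_of_eq {A : Type*} [CommRing A] {k : ℕ} (V : Matrix (Fin k) (Fin k) A)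
    (b : Fin k → A) (j : Fin k) (l : ℕ) (h : (j : ℕ) = l + 1) :
    (krylovMat V b).col j = (V ^ l) *ᵥ b := by
  ext i
  simp [krylovMat, Matrix.col, h]

/-- If `δ` is the last-column pairing, the row orbit times the Krylov matrix is
anti-triangular. -/
theorem det_rowOrbit_mul_det {A : Type*} [CommRing A] {k : ℕ}
    (V : Matrix (Fin (k + 1)) (Fin (k + 1)) A) (b f : Fin (k + 1) → A) (s δ : A)
    (hs : V *ᵥ Pi.single 0 1 = s • b)
    (hf0 : f ⬝ᵥ Pi.single 0 1 = 0)
    (hf : ∀ l, l + 1 < k → f ⬝ᵥ ((V ^ l) *ᵥ b) = 0)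
    (hδ : ∀ l, l + 1 = k → f ⬝ᵥ ((V ^ l) *ᵥ b) = δ) (hk : 0 < k) :
    (rowOrbit V f).det * ((krylovMat V b).submatrix id Fin.revPerm).det = s * δ ^ (k + 1) := by
  have hV0 : ∀ l : ℕ, (V ^ (l + 1)) *ᵥ Pi.single 0 1 = s • ((V ^ l) *ᵥ b) := by
    intro l
    rw [pow_succ, ← Matrix.mulVec_mulVec, hs, Matrix.mulVec_smul]
  have hentry0 : ∀ i : Fin (k + 1), (rowOrbit V f * krylovMat V b) i 0
      = f ⬝ᵥ ((V ^ (i : ℕ)) *ᵥ Pi.single 0 1) := by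
    intro i
    rw [← krylovMat_col_zero V b, Matrix.dotProduct_mulVec]
    rfl
  have hentry : ∀ (i j : Fin (k + 1)) (l : ℕ), (j : ℕ) = l + 1 →
      (rowOrbit V f * krylovMat V b) i j = f ⬝ᵥ ((V ^ (i + l : ℕ)) *ᵥ b) := by
    intro i j l h
    rw [pow_add, ← Matrix.mulVec_mulVec, ← krylovMat_col_of_eq V b j l h,
      Matrix.dotProduct_mulVec]
    rfl
  rw [← Matrix.det_mul]
  have hsub : rowOrbit V f * (krylovMat V b).submatrix id Fin.revPerm
      = (rowOrbit V f * krylovMat V b).submatrix id Fin.revPerm := by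
    ext i j; rfl
  rw [hsub, Matrix.det_of_isLowerTriangular]
  · rw [Fin.prod_univ_castSucc]
    have h1 : ∀ i : Fin k, ((rowOrbit V f * krylovMat V b).submatrix id Fin.revPerm)
        i.castSucc i.castSucc = δ := by
      intro i
      have hi := i.isLt
      rw [Matrix.submatrix_apply, id, hentry _ _ (k - 1 - i) (by simp [Fin.val_rev]; omega)]
      apply hδ
      simp; omega
    simp only [h1, Finset.prod_const, Finset.card_univ, Fintype.card_fin]
    have h2 : ((rowOrbit V f * krylovMat V b).submatrix id Fin.revPerm)
        (Fin.last k) (Fin.last k) = s * δ := by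
      rw [Matrix.submatrix_apply, id]
      simp only [Fin.revPerm_apply, Fin.rev_last]
      rw [hentry0]
      obtain ⟨l, rfl⟩ : ∃ l, k = l + 1 := ⟨k - 1, by omega⟩
      rw [Fin.val_last, hV0, dotProduct_smul, hδ l rfl, smul_eq_mul]
    rw [h2]; ring
  · intro i j hij
    have hij' : (i : ℕ) < j := by simpa using hij
    have hj := j.isLt
    rw [Matrix.submatrix_apply, id]
    by_cases hjk : (j : ℕ) = k
    · have : Fin.revPerm j = 0 := by
        ext; simp [Fin.val_rev]; omega
      rw [this, hentry0]
      rcases hi : (i : ℕ) with _ | l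
      · rw [pow_zero, Matrix.one_mulVec, hf0]
      · rw [hV0, dotProduct_smul, hf l (by omega), smul_zero]
    · rw [hentry _ _ (k - 1 - j) (by simp [Fin.val_rev]; omega)]
      apply hf; omega

theorem krylov_dvd {A : Type*} [CommRing A] [IsDomain A] {m : ℕ}
    (V : Matrix (Fin (m + 3)) (Fin (m + 3)) A) (b g σ : Fin (m + 3) → A) (s u : A)
    (hs : V *ᵥ Pi.single 0 1 = s • b) (hN : (krylovMat V b).det ≠ 0)
    (hσ0 : σ ⬝ᵥ Pi.single 0 1 = 0)
    (hσ : ∀ l, l < m + 1 → σ ⬝ᵥ ((V ^ l) *ᵥ b) = 0)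
    (hσu : σ ⬝ᵥ ((V ^ (m + 1)) *ᵥ b) = u * (krylovMat V b).det) :
    (krylovMat V b).det ∣ s * ((σ ⬝ᵥ (V *ᵥ g)) • (1 : Matrix _ _ A) - (σ ⬝ᵥ g) • V).det := by
  set N := krylovMat V b with hNdef
  set f : Fin (m + 3) → A := fun j => N.adjugate (Fin.last _) j with hfdef
  have hfN : ∀ j, f ⬝ᵥ N.col j = if j = Fin.last _ then N.det else 0 := by
    intro j
    have := congrFun (congrFun (Matrix.adjugate_mul N) (Fin.last _)) j
    rw [Matrix.smul_apply, Matrix.one_apply] at this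
    simp only [smul_eq_mul, mul_ite, mul_one, mul_zero] at this
    simp only [eq_comm (a := j)]
    rw [← this]; rfl
  have hf0 : f ⬝ᵥ Pi.single 0 1 = 0 := by
    rw [← krylovMat_col_zero V b, hfN, if_neg]
    simp [Fin.ext_iff]
  have hf : ∀ l, l + 1 < m + 2 → f ⬝ᵥ ((V ^ l) *ᵥ b) = 0 := by
    intro l hl
    rw [← krylovMat_col_of_eq V b ⟨l + 1, by omega⟩ l rfl, hfN, if_neg]
    simp [Fin.ext_iff]; omega
  have hfδ : ∀ l, l + 1 = m + 2 → f ⬝ᵥ ((V ^ l) *ᵥ b) = N.det := by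
    intro l hl
    rw [← krylovMat_col_of_eq V b ⟨l + 1, by omega⟩ l rfl, hfN, if_pos]
    simp [Fin.ext_iff]; omega
  have hσf : σ = u • f := by
    have h0 : (σ - u • f) ᵥ* N = 0 := by
      ext j
      have e : ((σ - u • f) ᵥ* N) j = σ ⬝ᵥ N.col j - u * (f ⬝ᵥ N.col j) := by
        rw [← smul_eq_mul, ← smul_dotProduct, ← sub_dotProduct]; rfl
      rw [e]
      rcases hj : (j : ℕ) with _ | l
      · have : j = 0 := Fin.ext hj
        rw [this, krylovMat_col_zero, hσ0, hf0]; simp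
      · rw [krylovMat_col_of_eq V b j l hj]
        have := j.isLt
        by_cases hl : l = m + 1
        · subst hl
          rw [hσu, hfδ _ rfl]; simp
        · rw [hσ l (by omega), hf l (by omega)]; simp
    exact sub_eq_zero.mp (Matrix.eq_zero_of_vecMul_eq_zero hN h0)
  set M := N.updateCol (Fin.last _) g with hMdef
  set q : Fin (m + 3) := ⟨m + 1, by omega⟩ with hq
  set h' : Fin (m + 3) → A := fun j => M.adjugate q j with hh'
  have hfx : ∀ x, f ⬝ᵥ x = (N.updateCol (Fin.last _) x).det := by
    intro x
    rw [← Matrix.cramer_apply, Matrix.cramer_eq_adjugate_mulVec]; rfl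
  have key : ∀ x, M.det * (f ⬝ᵥ (V *ᵥ x)) = N.det * (h' ⬝ᵥ x) + (f ⬝ᵥ (V *ᵥ g)) * (f ⬝ᵥ x) := by
    intro x
    have h1 := Matrix.mulVec_cramer M x
    have h2 : (f ᵥ* V) ⬝ᵥ (M *ᵥ (M.cramer x)) = M.det * (f ⬝ᵥ (V *ᵥ x)) := by
      rw [h1, dotProduct_smul, Matrix.dotProduct_mulVec, smul_eq_mul]
    rw [← h2, Matrix.dotProduct_mulVec]
    have hcol : ∀ j, ((f ᵥ* V) ᵥ* M) j = f ⬝ᵥ (V *ᵥ M.col j) := by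
      intro j
      rw [Matrix.dotProduct_mulVec]; rfl
    have hlast : ((f ᵥ* V) ᵥ* M) (Fin.last _) = f ⬝ᵥ (V *ᵥ g) := by
      rw [hcol]
      congr 2
      ext i; simp [M, Matrix.col]
    have hother : ∀ j, j ≠ Fin.last _ → M.col j = N.col j := by
      intro j hj
      ext i; simp [M, Matrix.col, Matrix.updateCol_ne hj]
    have hqv : ((f ᵥ* V) ᵥ* M) q = N.det := by
      rw [hcol, hother q (by simp [hq, Fin.ext_iff]), krylovMat_col_of_eq V b q m rfl,
        Matrix.mulVec_mulVec, ← pow_succ', hfδ _ rfl]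
    have hz : ∀ j, j ≠ Fin.last _ → j ≠ q → ((f ᵥ* V) ᵥ* M) j = 0 := by
      intro j hj hjq
      rw [hcol, hother j hj]
      rcases hj' : (j : ℕ) with _ | l
      · have : j = 0 := Fin.ext hj'
        rw [this, krylovMat_col_zero, hs, dotProduct_smul]
        have := hf 0 (by omega)
        rw [pow_zero, Matrix.one_mulVec] at this
        rw [this, smul_zero]
      · have := j.isLt
        have h3 : (j : ℕ) ≠ m + 2 := fun h => hj (Fin.ext h)
        have h4 : (j : ℕ) ≠ m + 1 := fun h => hjq (Fin.ext h)
        rw [krylovMat_col_of_eq V b j l hj', Matrix.mulVec_mulVec, ← pow_succ', hf _ (by omega)]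
    have hqne : q ≠ Fin.last _ := by simp [hq, Fin.ext_iff]
    rw [dotProduct, ← Finset.sum_subset (Finset.subset_univ {q, Fin.last _}), Finset.sum_pair hqne,
      hlast, hqv]
    · congr 2
      · rw [Matrix.cramer_eq_adjugate_mulVec]; rfl
      · rw [Matrix.cramer_apply, hfx]; simp [M]
    · intro j _ hj
      simp only [Finset.mem_insert, Finset.mem_singleton, not_or] at hj
      rw [hz j hj.2 hj.1, zero_mul]
  set B : Matrix (Fin (m + 3)) (Fin (m + 3)) A := (f ⬝ᵥ (V *ᵥ g)) • 1 - (f ⬝ᵥ g) • V with hB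
  have hBσ : (σ ⬝ᵥ (V *ᵥ g)) • (1 : Matrix (Fin (m + 3)) (Fin (m + 3)) A) - (σ ⬝ᵥ g) • V
      = u • B := by
    rw [hσf, hB, smul_sub, smul_smul, smul_smul, smul_dotProduct, smul_dotProduct, smul_eq_mul,
      smul_eq_mul]
  have hfB : f ᵥ* B = (-N.det) • h' := by
    ext j
    have := key (Pi.single j 1)
    simp only [dotProduct_single_one] at this
    have hfg : f ⬝ᵥ g = M.det := hfx g
    have e : f ⬝ᵥ (V *ᵥ Pi.single j 1) = (f ᵥ* V) j := by
      rw [Matrix.dotProduct_mulVec, dotProduct_single_one]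
    rw [e] at this
    simp only [hB, Matrix.vecMul_sub, Matrix.vecMul_smul, Matrix.vecMul_one, Pi.sub_apply,
      Pi.smul_apply, smul_eq_mul, hfg]
    linear_combination -this
  have hcomm : Commute V B := by
    rw [hB]
    exact (Commute.smul_right (Commute.one_right V) _).sub_right
      (Commute.smul_right (Commute.refl V) _)
  have hdet : (rowOrbit V f).det * B.det = (-N.det) ^ (m + 3) * (rowOrbit V h').det := by
    rw [← Matrix.det_mul, rowOrbit_mul_of_commute hcomm, hfB, rowOrbit_smul, Matrix.det_smul,
      Fintype.card_fin]
  have hFN := det_rowOrbit_mul_det V b f s N.det hs hf0 hf hfδ (by omega)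
  rw [Matrix.det_permute'] at hFN
  set ε : ℤˣ := Equiv.Perm.sign (Fin.revPerm : Equiv.Perm (Fin (m + 2 + 1)))
  have hfin : N.det ^ (m + 3) * (s * B.det)
      = N.det ^ (m + 3) * (N.det * ((-1) ^ (m + 3) * (rowOrbit V h').det * ((ε : ℤ) : A))) := by
    rw [neg_pow] at hdet
    calc _ = (s * N.det ^ (m + 2 + 1)) * B.det := by ring
      _ = ((rowOrbit V f).det * B.det) * ((ε : ℤ) * N.det) := by rw [← hFN]; ring
      _ = _ := by rw [hdet]; ring
  have := mul_left_cancel₀ (pow_ne_zero _ hN) hfin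
  rw [hBσ, Matrix.det_smul, mul_left_comm, this]
  exact Dvd.dvd.mul_left (Dvd.intro _ rfl) _

/-- A minor of an invertible matrix agrees with the complementary minor of its inverse up to a
unit. -/
theorem exists_unit_det_submatrix {A m m' p : Type*} [CommRing A] [Fintype m] [DecidableEq m]
    [Fintype m'] [DecidableEq m'] [Fintype p] [DecidableEq p] {P Q : Matrix p p A}
    (h : P * Q = 1) (er ec : m ⊕ m' ≃ p) :
    ∃ u : A, IsUnit u ∧ (P.submatrix (er ∘ Sum.inl) (ec ∘ Sum.inl)).det
      = u * (Q.submatrix (ec ∘ Sum.inr) (er ∘ Sum.inr)).det := by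
  have h1 : P.submatrix er ec * Q.submatrix ec er = 1 := by
    rw [Matrix.submatrix_mul_equiv, h, Matrix.submatrix_one_equiv]
  refine ⟨(P.submatrix er ec).det, ?_, ?_⟩
  · refine IsUnit.of_mul_eq_one (Q.submatrix ec er).det ?_
    rw [← Matrix.det_mul, h1, Matrix.det_one]
  · set P' := P.submatrix er ec
    set Q' := Q.submatrix ec er
    have h2 : fromBlocks (P'.toBlocks₁₁ * Q'.toBlocks₁₁ + P'.toBlocks₁₂ * Q'.toBlocks₂₁)
        (P'.toBlocks₁₁ * Q'.toBlocks₁₂ + P'.toBlocks₁₂ * Q'.toBlocks₂₂)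
        (P'.toBlocks₂₁ * Q'.toBlocks₁₁ + P'.toBlocks₂₂ * Q'.toBlocks₂₁)
        (P'.toBlocks₂₁ * Q'.toBlocks₁₂ + P'.toBlocks₂₂ * Q'.toBlocks₂₂)
        = fromBlocks 1 0 0 1 := by
      rw [← Matrix.fromBlocks_multiply, Matrix.fromBlocks_toBlocks, Matrix.fromBlocks_toBlocks,
        Matrix.fromBlocks_one, h1]
    obtain ⟨-, h12, -, h22⟩ := Matrix.fromBlocks_inj.mp h2
    have h3 : P' * fromBlocks 1 Q'.toBlocks₁₂ 0 Q'.toBlocks₂₂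
        = fromBlocks P'.toBlocks₁₁ 0 P'.toBlocks₂₁ 1 := by
      conv_lhs => rw [← Matrix.fromBlocks_toBlocks P', Matrix.fromBlocks_multiply]
      simp [h12, h22]
    have h4 := congrArg Matrix.det h3
    rw [Matrix.det_mul, Matrix.det_fromBlocks_zero₂₁, Matrix.det_fromBlocks_zero₁₂, Matrix.det_one,
      Matrix.det_one, one_mul, mul_one] at h4
    exact h4.symm

/-- The block lower bidiagonal matrix with `Y` on the diagonal and `X` just below it. -/
def blockBidiag {A : Type*} [Zero A] {n : ℕ} (m : ℕ) (X Y : Matrix (Fin n) (Fin n) A) :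
    Matrix (Fin m × Fin n) (Fin m × Fin n) A :=
  Matrix.of fun p q =>
    if (p.1 : ℕ) = q.1 then Y p.2 q.2 else if (p.1 : ℕ) = q.1 + 1 then X p.2 q.2 else 0

/-- The inverse of `blockBidiag` when `Y * W = 1` and `Y * V = -X`. -/
def blockBidiagInv {A : Type*} [CommRing A] {n : ℕ} (m : ℕ) (V W : Matrix (Fin n) (Fin n) A) :
    Matrix (Fin m × Fin n) (Fin m × Fin n) A :=
  Matrix.of fun p q =>
    if (q.1 : ℕ) ≤ p.1 then (V ^ ((p.1 : ℕ) - q.1) * W) p.2 q.2 else 0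

theorem blockBidiag_mul_inv {A : Type*} [CommRing A] {n m : ℕ} {X Y V W : Matrix (Fin n) (Fin n) A}
    (hW : Y * W = 1) (hV : Y * V = -X) : blockBidiag m X Y * blockBidiagInv m V W = 1 := by
  ext ⟨j, i⟩ ⟨l, c⟩
  let C : ℕ → Matrix (Fin n) (Fin n) A := fun t =>
    if (l : ℕ) ≤ t then V ^ (t - (l : ℕ)) * W else 0
  have h1 : (blockBidiag m X Y * blockBidiagInv m V W) (j, i) (l, c)
      = ∑ t : Fin m, ((if j = t then (Y * C t) i c else 0)
        + (if (j : ℕ) = t + 1 then (X * C t) i c else 0)) := by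
    rw [Matrix.mul_apply, Fintype.sum_prod_type]
    refine Finset.sum_congr rfl fun t _ => ?_
    have hC : ∀ r, blockBidiagInv m V W (t, r) (l, c) = C t r c := by
      intro r
      simp only [blockBidiagInv, Matrix.of_apply, C]
      split_ifs <;> rfl
    simp only [hC, Matrix.mul_apply, blockBidiag, Matrix.of_apply, Fin.ext_iff]
    by_cases h : (j : ℕ) = t
    · have : (j : ℕ) ≠ t + 1 := by omega
      simp [h]
    · by_cases h' : (j : ℕ) = t + 1 <;> simp [h']
  rw [h1, Finset.sum_add_distrib, Finset.sum_ite_eq, if_pos (Finset.mem_univ _)]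
  have h2 : ∑ t : Fin m, (if (j : ℕ) = t + 1 then (X * C t) i c else 0)
      = if 1 ≤ (j : ℕ) then (X * C ((j : ℕ) - 1)) i c else 0 := by
    split_ifs with hj
    · have := j.isLt
      rw [Finset.sum_eq_single ⟨(j : ℕ) - 1, by omega⟩]
      · rw [if_pos]; simp; omega
      · intro t _ ht
        rw [if_neg]
        intro h; apply ht; ext; simp; omega
      · simp
    · refine Finset.sum_eq_zero fun t _ => if_neg (by omega)
  rw [h2, Matrix.one_apply]
  by_cases hjl : j = l
  · subst hjl
    have hz : (if 1 ≤ (j : ℕ) then (X * C ((j : ℕ) - 1)) i c else 0) = 0 := by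
      split_ifs with hj
      · simp only [C]; rw [if_neg (by omega)]; simp
      · rfl
    rw [hz]
    simp [C, hW, Matrix.one_apply, Prod.ext_iff]
  · rw [if_neg (show ¬ (j, i) = (l, c) from fun h => hjl (congrArg Prod.fst h))]
    by_cases hlt : (l : ℕ) < j
    · rw [if_pos (show 1 ≤ (j : ℕ) by omega)]
      simp only [C]
      rw [if_pos (show (l : ℕ) ≤ j by omega), if_pos (show (l : ℕ) ≤ j - 1 by omega),
        ← Matrix.add_apply]
      obtain ⟨e, he⟩ : ∃ e, (j : ℕ) - l = e + 1 := ⟨j - l - 1, by omega⟩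
      rw [he, show (j : ℕ) - 1 - l = e by omega, pow_succ', Matrix.mul_assoc, ← Matrix.mul_assoc Y,
        hV, Matrix.neg_mul]
      simp
    · have hne : (j : ℕ) ≠ l := fun h => hjl (Fin.ext h)
      have hz : ∀ t, t ≤ (j : ℕ) → C t = 0 := by
        intro t ht
        simp only [C]; rw [if_neg (by omega)]
      rw [hz _ le_rfl, hz _ (Nat.sub_le _ _)]
      simp

theorem mulVec_pow_natAdd {A : Type*} [CommRing A] {d k : ℕ}
    {V : Matrix (Fin (d + k)) (Fin (d + k)) A} (hV : ∀ i j, V i (Fin.castAdd k j) = 0)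
    (x : Fin (d + k) → A) (l : ℕ) (i : Fin k) :
    (V ^ l *ᵥ x) (Fin.natAdd d i)
      = ((V.submatrix (Fin.natAdd d) (Fin.natAdd d)) ^ l *ᵥ fun i => x (Fin.natAdd d i)) i := by
  induction l generalizing i with
  | zero => simp
  | succ l ih =>
    rw [pow_succ', pow_succ', ← Matrix.mulVec_mulVec, ← Matrix.mulVec_mulVec]
    conv_lhs => rw [Matrix.mulVec, dotProduct, Fin.sum_univ_add]
    simp only [hV, zero_mul, Finset.sum_const_zero, zero_add, ih]
    rfl

theorem det_smul_add_smul_of_cols_eq_zero {A : Type*} [CommRing A] {d k : ℕ}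
    {X Y W : Matrix (Fin (d + k)) (Fin (d + k)) A} (hW : Y * W = 1)
    (hX : ∀ i j, X i (Fin.castAdd k j) = 0) (l u : A) :
    (l • Y + u • X).det = Y.det * (l ^ d *
      (l • (1 : Matrix (Fin k) (Fin k) A)
        - u • (-(W * X)).submatrix (Fin.natAdd d) (Fin.natAdd d)).det) := by
  have h1 : l • Y + u • X = Y * (l • 1 - u • (-(W * X))) := by
    rw [Matrix.mul_sub, Matrix.mul_smul, Matrix.mul_smul, Matrix.mul_neg, ← Matrix.mul_assoc, hW]
    simp
  rw [h1, Matrix.det_mul]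
  congr 1
  set V := -(W * X) with hVdef
  have hV : ∀ i j, V i (Fin.castAdd k j) = 0 := by
    intro i j
    simp [hVdef, Matrix.mul_apply, hX]
  rw [← Matrix.det_submatrix_equiv_self finSumFinEquiv]
  have h2 : (l • (1 : Matrix (Fin (d + k)) (Fin (d + k)) A) - u • V).submatrix
      finSumFinEquiv finSumFinEquiv
      = fromBlocks (l • 1) (-(u • V.submatrix (Fin.castAdd k) (Fin.natAdd d))) 0
        (l • 1 - u • V.submatrix (Fin.natAdd d) (Fin.natAdd d)) := by
    ext (i | i) (j | j)
    · simp [hV, Matrix.one_apply]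
    · have : Fin.castAdd k i ≠ Fin.natAdd d j := by
        have := i.isLt
        simp [Fin.ext_iff]; omega
      simp [this]
    · have : Fin.natAdd d i ≠ Fin.castAdd k j := by
        have := j.isLt
        simp [Fin.ext_iff]; omega
      simp [hV, this]
    · simp [Matrix.one_apply]
  rw [h2, Matrix.det_fromBlocks_zero₂₁, Matrix.det_smul]
  simp

/-- The rows of the full block bidiagonal matrix, split into the rows of the core and the first
rows of the blocks (in reverse order). -/
def coreRowsFun (m d : ℕ) :
    Fin ((m + 2) * (d + m + 2)) ⊕ Fin (m + 2) → Fin (m + 2) × Fin (d + (m + 3))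
  | Sum.inl r => (⟨(r : ℕ) / (d + m + 2), Nat.div_lt_of_lt_mul (lt_of_lt_of_eq r.isLt (mul_comm _ _))⟩,
      ⟨(r : ℕ) % (d + m + 2) + 1, by have := Nat.mod_lt (r : ℕ) (show 0 < d + m + 2 by omega); omega⟩)
  | Sum.inr j => (Fin.rev j, ⟨0, by omega⟩)

/-- The columns of the full block bidiagonal matrix, split into those of the truncated core and
the last `m + 2` ones. -/
def coreColsFun (m d : ℕ) :
    Fin ((m + 2) * (d + m + 2)) ⊕ Fin (m + 2) → Fin (m + 2) × Fin (d + (m + 3))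
  | Sum.inl c => (⟨(c : ℕ) / (d + (m + 3)), Nat.div_lt_of_lt_mul (by
        have := c.isLt
        nlinarith)⟩,
      ⟨(c : ℕ) % (d + (m + 3)), Nat.mod_lt _ (by omega)⟩)
  | Sum.inr j => (Fin.last _, Fin.natAdd d j.succ)

theorem card_core_split (m d : ℕ) :
    Fintype.card (Fin ((m + 2) * (d + m + 2)) ⊕ Fin (m + 2))
      = Fintype.card (Fin (m + 2) × Fin (d + (m + 3))) := by
  simp only [Fintype.card_sum, Fintype.card_prod, Fintype.card_fin]
  ring

theorem coreRowsFun_bijective (m d : ℕ) : Function.Bijective (coreRowsFun m d) := by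
  rw [Fintype.bijective_iff_injective_and_card]
  refine ⟨?_, card_core_split m d⟩
  rintro (r | j) (r' | j') h
  · simp only [coreRowsFun, Prod.mk.injEq, Fin.mk.injEq, Nat.add_right_cancel_iff] at h
    congr 1
    ext
    rw [← Nat.div_add_mod (r : ℕ) (d + m + 2), ← Nat.div_add_mod (r' : ℕ) (d + m + 2), h.1, h.2]
  · simp [coreRowsFun] at h
  · simp [coreRowsFun] at h
  · simp only [coreRowsFun, Prod.mk.injEq, and_true] at h
    rw [Fin.rev_injective h]

theorem coreColsFun_bijective (m d : ℕ) : Function.Bijective (coreColsFun m d) := by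
  rw [Fintype.bijective_iff_injective_and_card]
  refine ⟨?_, card_core_split m d⟩
  have aux : ∀ (c : Fin ((m + 2) * (d + m + 2))) (j : Fin (m + 2)),
      coreColsFun m d (Sum.inl c) ≠ coreColsFun m d (Sum.inr j) := by
    intro c j h
    simp only [coreColsFun, Prod.mk.injEq, Fin.ext_iff, Fin.val_last, Fin.val_natAdd,
      Fin.val_succ] at h
    have h1 := Nat.div_add_mod (c : ℕ) (d + (m + 3))
    rw [h.1, h.2] at h1
    have := c.isLt
    nlinarith
  rintro (r | j) (r' | j') h
  · simp only [coreColsFun, Prod.mk.injEq, Fin.mk.injEq] at h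
    congr 1
    ext
    rw [← Nat.div_add_mod (r : ℕ) (d + (m + 3)), ← Nat.div_add_mod (r' : ℕ) (d + (m + 3)), h.1, h.2]
  · exact (aux _ _ h).elim
  · exact (aux _ _ h.symm).elim
  · simp only [coreColsFun, Prod.mk.injEq, Fin.ext_iff, Fin.val_natAdd, Fin.val_succ] at h
    congr 1
    ext
    omega

def coreRows (m d : ℕ) :
    Fin ((m + 2) * (d + m + 2)) ⊕ Fin (m + 2) ≃ Fin (m + 2) × Fin (d + (m + 3)) :=
  Equiv.ofBijective _ (coreRowsFun_bijective m d)

def coreCols (m d : ℕ) :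
    Fin ((m + 2) * (d + m + 2)) ⊕ Fin (m + 2) ≃ Fin (m + 2) × Fin (d + (m + 3)) :=
  Equiv.ofBijective _ (coreColsFun_bijective m d)

theorem stairCore_eq_blockBidiag {A : Type*} [CommRing A] (m d : ℕ) (Xf Yf : ℕ → ℕ → A)
    (r c : Fin ((m + 2) * (d + m + 2))) :
    stairCore (d + (m + 3)) (m + 3) Xf Yf r c
      = blockBidiag (m + 2) (toSq _ Xf) (toSq _ Yf) (coreRows m d (Sum.inl r))
          (coreCols m d (Sum.inl c)) := by
  have hq : d + (m + 3) - 1 = d + m + 2 := by omega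
  have hk : m + 3 - 1 = m + 2 := by omega
  have hr := r.isLt
  have h1 := Nat.div_add_mod (c : ℕ) (d + (m + 3))
  have h2 := Nat.mod_lt (c : ℕ) (show 0 < d + (m + 3) by omega)
  simp only [stairCore, hq, hk, if_pos hr, blockBidiag, coreRows, coreCols, Equiv.ofBijective_apply,
    coreRowsFun, coreColsFun, Matrix.of_apply, toSq]
  generalize (r : ℕ) / (d + m + 2) = R
  have hw : ∀ t, (t * (d + (m + 3)) ≤ (c : ℕ) ∧ (c : ℕ) < t * (d + (m + 3)) + (d + (m + 3))) ↔
      (c : ℕ) / (d + (m + 3)) = t := by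
    intro t
    rw [Nat.div_eq_iff (by omega)]
    constructor
    · intro h; exact ⟨h.1, by omega⟩
    · intro h; exact ⟨h.1, by omega⟩
  generalize (c : ℕ) / (d + (m + 3)) = w at *
  generalize (c : ℕ) % (d + (m + 3)) = z at *
  generalize (c : ℕ) = c' at *
  generalize d + (m + 3) = n at *
  have hsub : c' - w * n = z := by
    rw [mul_comm]
    omega
  have hww := (hw w).mpr rfl
  by_cases hR : R = w
  · subst hR
    simp only [if_pos hww, if_true, hsub]
  · rw [if_neg (fun h => hR ((hw R).mp h).symm), if_neg hR]
    by_cases hR1 : R = w + 1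
    · subst hR1
      have h3 : (w + 1) * n = w * n + n := by ring
      rw [Nat.add_sub_cancel, if_pos ⟨by omega, hww.1, by omega⟩, if_pos rfl, hsub]
    · rw [if_neg, if_neg hR1]
      rintro ⟨h5, h6, h7⟩
      obtain ⟨t, rfl⟩ : ∃ t, R = t + 1 := ⟨R - 1, by omega⟩
      rw [Nat.add_sub_cancel] at h6
      have h3 : (t + 1) * n = t * n + n := by ring
      exact hR1 (by rw [(hw t).mp ⟨h6, by omega⟩])

theorem det_krylovMat {A : Type*} [CommRing A] {k : ℕ} (V : Matrix (Fin (k + 1)) (Fin (k + 1)) A)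
    (b : Fin (k + 1) → A) :
    (krylovMat V b).det
      = (Matrix.of fun i j : Fin k => ((V ^ (j : ℕ)) *ᵥ b) i.succ).det := by
  rw [Matrix.det_succ_column_zero, Fin.sum_univ_succ]
  rw [Finset.sum_eq_zero]
  · simp only [krylovMat, Matrix.of_apply, Fin.val_zero, if_true, pow_zero, one_mul, add_zero]
    congr 1
  · intro i _
    simp [krylovMat]

theorem stairCore_det_dvd {A : Type*} [CommRing A] [IsDomain A] {m d : ℕ}
    (Xf Yf : ℕ → ℕ → A) (W : Matrix (Fin (d + (m + 3))) (Fin (d + (m + 3))) A)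
    (hW : toSq _ Yf * W = 1) (hX0 : ∀ i j, j < d → Xf i j = 0) (hX1 : ∀ i, i ≠ 0 → Xf i d = 0)
    (hY : ∀ j, j ≠ 0 → Yf 0 j = 0)
    (Φ : Matrix (Fin ((m + 2) * (d + m + 2))) (Fin ((m + 2) * (d + m + 2))) A)
    (hΦ : Φ = Matrix.of fun r c : Fin ((m + 2) * (d + m + 2)) =>
      stairCore (d + (m + 3)) (m + 3) Xf Yf r c)
    (hne : Φ.det ≠ 0) (r0 r1 : Fin ((m + 2) * (d + m + 2))) (hr0 : (r0 : ℕ) = 0)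
    (hr1 : (r1 : ℕ) = d + m + 2) :
    Φ.det ∣ Xf 0 d * (Φ.adjugate r0 r0 • (1 : Matrix (Fin (m + 3)) (Fin (m + 3)) A)
      - Φ.adjugate r0 r1 •
        (-(W * toSq _ Xf)).submatrix (Fin.natAdd d) (Fin.natAdd d)).det := by
  set Vn := -(W * toSq _ Xf) with hVn
  set V := Vn.submatrix (Fin.natAdd d) (Fin.natAdd d : Fin (m + 3) → _) with hVdef
  set P := blockBidiag (m + 2) (toSq (d + (m + 3)) Xf) (toSq _ Yf) with hP
  set Q := blockBidiagInv (m + 2) Vn W with hQ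
  have hYV : toSq _ Yf * Vn = -toSq _ Xf := by
    rw [hVn, Matrix.mul_neg, ← Matrix.mul_assoc, hW, Matrix.one_mul]
  have hPQ : P * Q = 1 := blockBidiag_mul_inv hW hYV
  have hVn0 : ∀ i j, Vn i (Fin.castAdd (m + 3) j) = 0 := by
    intro i j
    simp [hVn, Matrix.mul_apply, toSq, hX0]
  let i0 : Fin (d + (m + 3)) := ⟨0, by omega⟩
  let i1 : Fin (d + (m + 3)) := ⟨1, by omega⟩
  have hW0 : ∀ i, toSq _ Yf i0 i0 * W i0 i = (1 : Matrix _ _ A) i0 i := by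
    intro i
    rw [← hW, Matrix.mul_apply, Finset.sum_eq_single i0]
    · intro j _ hj
      have : (j : ℕ) ≠ 0 := fun h => hj (Fin.ext h)
      simp [toSq, i0, hY _ this]
    · simp
  have hW01 : W i0 i1 = 0 := by
    have h1 := hW0 i1
    have h0 := hW0 i0
    rw [Matrix.one_apply_eq] at h0
    rw [Matrix.one_apply_ne (by simp [i0, i1])] at h1
    exact (mul_eq_zero.mp h1).resolve_left (left_ne_zero_of_mul_eq_one h0)
  let bv : Fin (d + (m + 3)) → Fin (m + 3) → A := fun i t => W (Fin.natAdd d t) i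
  have hQlast : ∀ (t : Fin (m + 3)) (j : Fin (m + 2)) (i : Fin (d + (m + 3))),
      Q (Fin.last _, Fin.natAdd d t) (j, i) = (V ^ (m + 1 - (j : ℕ)) *ᵥ bv i) t := by
    intro t j i
    have hj := j.isLt
    simp only [hQ, blockBidiagInv, Matrix.of_apply, Fin.val_last]
    rw [if_pos (by omega), hVdef, ← mulVec_pow_natAdd hVn0 (fun s => W s i)]
    rfl
  -- the determinant of the core as a Krylov determinant
  obtain ⟨u, hu, hdet⟩ := exists_unit_det_submatrix hPQ (coreRows m d) (coreCols m d)
  have hΦP : Φ = P.submatrix (coreRows m d ∘ Sum.inl) (coreCols m d ∘ Sum.inl) := by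
    rw [hΦ]
    ext r c
    exact stairCore_eq_blockBidiag m d Xf Yf r c
  rw [← hΦP] at hdet
  have hQN : (Q.submatrix (coreCols m d ∘ Sum.inr) (coreRows m d ∘ Sum.inr)).det
      = (krylovMat V (bv i0)).det := by
    rw [det_krylovMat]
    congr 1
    ext t j
    have hj := j.isLt
    have := hQlast t.succ (Fin.rev j) i0
    rw [Fin.val_rev, show m + 1 - (m + 2 - ((j : ℕ) + 1)) = j by omega] at this
    exact this
  rw [hQN] at hdet
  -- the first row of the adjugate
  let α' : Fin (m + 2) × Fin (d + (m + 3)) → A :=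
    (Sum.elim (fun r => Φ.adjugate r0 r) 0) ∘ (coreRows m d).symm
  have hα'l : ∀ r, α' (coreRows m d (Sum.inl r)) = Φ.adjugate r0 r := by
    intro r; simp [α']
  have hα'r : ∀ j, α' (coreRows m d (Sum.inr j)) = 0 := by
    intro r; simp [α']
  set β := α' ᵥ* P with hβ
  have hβα : β ᵥ* Q = α' := by
    rw [hβ, Matrix.vecMul_vecMul, hPQ, Matrix.vecMul_one]
  have hβl : ∀ c, β (coreCols m d (Sum.inl c)) = if c = r0 then Φ.det else 0 := by
    intro c
    have h1 := congrFun (congrFun (Matrix.adjugate_mul Φ) r0) c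
    rw [Matrix.smul_apply, Matrix.one_apply, Matrix.mul_apply] at h1
    simp only [smul_eq_mul, mul_ite, mul_one, mul_zero, eq_comm (a := r0)] at h1
    rw [← h1, hβ, Matrix.vecMul, dotProduct, ← (coreRows m d).sum_comp, Fintype.sum_sum_type]
    simp only [hα'l, hα'r, zero_mul, Finset.sum_const_zero, add_zero]
    refine Finset.sum_congr rfl fun r _ => ?_
    rw [hΦP]; rfl
  let σ : Fin (m + 3) → A := Fin.cons 0 fun j => β (coreCols m d (Sum.inr j))
  have hα'eq : ∀ j i, α' (j, i) = Φ.det * Q (⟨0, by omega⟩, i0) (j, i)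
      + σ ⬝ᵥ (V ^ (m + 1 - (j : ℕ)) *ᵥ bv i) := by
    intro j i
    rw [← hβα, Matrix.vecMul, dotProduct, ← (coreCols m d).sum_comp, Fintype.sum_sum_type]
    congr 1
    · simp only [hβl, ite_mul, zero_mul, Finset.sum_ite_eq', Finset.mem_univ, if_true]
      congr 2
      simp [coreCols, coreColsFun, hr0, i0]
    · have hσsum : ∀ v : Fin (m + 3) → A,
          σ ⬝ᵥ v = ∑ t : Fin (m + 2), β (coreCols m d (Sum.inr t)) * v t.succ := by
        intro v
        rw [dotProduct, Fin.sum_univ_succ]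
        simp [σ]
      rw [hσsum]
      refine Finset.sum_congr rfl fun t _ => ?_
      rw [← hQlast]; rfl
  have hα'0 : ∀ j, α' (j, i0) = 0 := by
    intro j
    have : (j, i0) = coreRows m d (Sum.inr (Fin.rev j)) := by
      simp [coreRows, coreRowsFun, i0]
    rw [this, hα'r]
  have hQne : ∀ (j : Fin (m + 2)) (i : Fin (d + (m + 3))), (j : ℕ) ≠ 0 →
      Q (⟨0, by omega⟩, i0) (j, i) = 0 := by
    intro j i hj
    simp only [hQ, blockBidiagInv, Matrix.of_apply]
    rw [if_neg (by omega)]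
  have hQ0 : ∀ i, Q (⟨0, by omega⟩, i0) (⟨0, by omega⟩, i) = W i0 i := by
    intro i
    simp [hQ, blockBidiagInv]
  set g := V ^ m *ᵥ bv i1 with hg
  have h00 : Φ.adjugate r0 r0 = σ ⬝ᵥ (V *ᵥ g) := by
    have h1 := hα'eq ⟨0, by omega⟩ i1
    have h2 : ((⟨0, by omega⟩, i1) : Fin (m + 2) × Fin (d + (m + 3)))
        = coreRows m d (Sum.inl r0) := by
      simp [coreRows, coreRowsFun, i1, hr0]
    rw [hQ0, hW01, mul_zero, zero_add, h2, hα'l] at h1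
    rw [h1, hg, Matrix.mulVec_mulVec, ← pow_succ']
    rfl
  have h01 : Φ.adjugate r0 r1 = σ ⬝ᵥ g := by
    have h1 := hα'eq ⟨1, by omega⟩ i1
    have h2 : ((⟨1, by omega⟩, i1) : Fin (m + 2) × Fin (d + (m + 3)))
        = coreRows m d (Sum.inl r1) := by
      simp [coreRows, coreRowsFun, i1, hr1]
    rw [hQne _ _ (by simp), mul_zero, zero_add, h2, hα'l] at h1
    rw [h1]
    rfl
  have hN : (krylovMat V (bv i0)).det ≠ 0 := by
    intro h
    rw [h, mul_zero] at hdet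
    exact hne hdet
  have hs : V *ᵥ Pi.single 0 1 = (-Xf 0 d) • bv i0 := by
    ext t
    rw [Matrix.mulVec_single_one]
    simp only [hVdef, hVn, Matrix.col_apply, Matrix.submatrix_apply, Matrix.neg_apply,
      Matrix.mul_apply, Pi.smul_apply, smul_eq_mul, bv]
    rw [Finset.sum_eq_single i0]
    · simp [toSq, i0, mul_comm]
    · intro c _ hc
      have : (c : ℕ) ≠ 0 := fun h => hc (Fin.ext h)
      simp [toSq, hX1 _ this]
    · simp
  have hσ0 : σ ⬝ᵥ Pi.single 0 1 = 0 := by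
    simp [σ]
  have hσ : ∀ l, l < m + 1 → σ ⬝ᵥ ((V ^ l) *ᵥ bv i0) = 0 := by
    intro l hl
    have h1 := hα'eq ⟨m + 1 - l, by omega⟩ i0
    rw [hα'0, hQne _ _ (by simp; omega), mul_zero, zero_add] at h1
    rw [h1]
    simp only
    rw [show m + 1 - (m + 1 - l) = l by omega]
  have hσu : σ ⬝ᵥ ((V ^ (m + 1)) *ᵥ bv i0) = (-(W i0 i0 * u)) * (krylovMat V (bv i0)).det := by
    have h1 := hα'eq ⟨0, by omega⟩ i0
    rw [hα'0, hQ0, hdet] at h1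
    simp only [Nat.sub_zero] at h1
    linear_combination -h1
  have hdvd := krylov_dvd V (bv i0) g σ _ _ hs hN hσ0 hσ hσu
  rw [neg_mul, dvd_neg] at hdvd
  rw [h00, h01, hdet]
  exact (hu.mul_left_dvd).mpr hdvd

theorem sminor_eq_det {A : Type*} [CommRing A] (f : ℕ → ℕ → A) {i M p : ℕ} (h : M + 1 - i = p) :
    sminor f i M = (Matrix.of fun r c : Fin p => f (i - 1 + (r : ℕ)) (i - 1 + (c : ℕ))).det := by
  subst h
  rfl

theorem adjugate_zero_zero_eq_sminor {A : Type*} [CommRing A] {N : ℕ} (f : ℕ → ℕ → A)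
    (r : Fin N) (hr : (r : ℕ) = 0) :
    (Matrix.of fun r c : Fin N => f r c).adjugate r r = sminor f 2 N := by
  obtain _ | N := N
  · exact r.elim0
  obtain rfl : r = 0 := Fin.ext hr
  rw [Matrix.adjugate_fin_succ_eq_det_submatrix, sminor_eq_det f (show N + 1 + 1 - 2 = N by omega)]
  simp only [Fin.val_zero, add_zero, pow_zero, one_mul]
  congr 1
  ext i j
  simp [add_comm]

theorem adjugate_zero_eq_sminor_of_zero {A : Type*} [CommRing A] {N q : ℕ} (f : ℕ → ℕ → A)
    (r0 r1 : Fin N) (h0 : (r0 : ℕ) = 0) (h1 : (r1 : ℕ) = q)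
    (hf : ∀ r c, r < q → q < c → f r c = 0) :
    (Matrix.of fun r c : Fin N => f r c).adjugate r0 r1
      = (-1) ^ q * (Matrix.of fun r c : Fin q => f r (c + 1)).det * sminor f (q + 2) N := by
  obtain ⟨p, rfl⟩ : ∃ p, N = q + p + 1 := ⟨N - q - 1, by have := r1.isLt; omega⟩
  obtain rfl : r0 = 0 := Fin.ext h0
  rw [Matrix.adjugate_fin_succ_eq_det_submatrix,
    sminor_eq_det f (show q + p + 1 + 1 - (q + 2) = p by omega), h1, Fin.val_zero, add_zero,
    mul_assoc]
  congr 1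
  rw [← Matrix.det_submatrix_equiv_self finSumFinEquiv, ← Matrix.det_fromBlocks_zero₁₂ _
    (Matrix.of fun (i : Fin p) (j : Fin q) => f (q + 1 + i) (j + 1))]
  congr 1
  have hl : ∀ i : Fin q, ((r1.succAbove (Fin.castAdd p i) : Fin _) : ℕ) = i := by
    intro i
    rw [Fin.succAbove_of_castSucc_lt]
    · simp
    · simp [Fin.lt_def, h1]
  have hr : ∀ i : Fin p, ((r1.succAbove (Fin.natAdd q i) : Fin _) : ℕ) = q + 1 + i := by
    intro i
    rw [Fin.succAbove_of_le_castSucc]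
    · simp; omega
    · simp [Fin.le_def, h1]
  ext (i | i) (j | j)
  · simp [hl]
  · simp [hl]
    exact hf _ _ i.isLt (by omega)
  · simp [hr]
  · simp [hr]
    congr 1
    omega

theorem stairCore_of_lt {A : Type*} [Zero A] {n k r : ℕ} (hk : 2 ≤ k) (Xf Yf : ℕ → ℕ → A)
    (hr : r < n - 1) (c : ℕ) :
    stairCore n k Xf Yf r c = if c < n then Yf (r + 1) c else 0 := by
  have h1 : r < (k - 1) * (n - 1) := lt_of_lt_of_le hr (Nat.le_mul_of_pos_left _ (by omega))
  simp [stairCore, if_pos h1, Nat.div_eq_of_lt hr, Nat.mod_eq_of_lt hr]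

theorem det_bandY_trailing {A : Type*} [CommRing A] {n k q s : ℕ} (hq : q + s = n)
    (a : ℕ → ℕ → A) :
    (Matrix.of fun r c : Fin q => bandY n k a (r + s) (c + s)).det
      = ∏ j ∈ Finset.Icc (s + 1) n, a (k + 1) j := by
  have htri : (Matrix.of fun r c : Fin q => bandY n k a (r + s) (c + s)).IsLowerTriangular := by
    intro i j hij
    have : (i : ℕ) < j := hij
    simp only [Matrix.of_apply, bandY]
    rw [if_neg (by omega)]
  rw [Matrix.det_of_isLowerTriangular _ htri]
  have hdiag : ∀ i : Fin q, (Matrix.of fun r c : Fin q => bandY n k a (r + s) (c + s)) i i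
      = a (k + 1) (s + 1 + i) := by
    intro i
    have := i.isLt
    simp only [Matrix.of_apply, bandY]
    rw [if_pos (by omega)]
    congr 1 <;> omega
  rw [Finset.prod_congr rfl fun i _ => hdiag i,
    Fin.prod_univ_eq_prod_range (fun i => a (k + 1) (s + 1 + i)) q,
    ← Finset.Ico_add_one_right_eq_Icc, Finset.prod_Ico_eq_prod_range]
  congr 2
  omega

/-- The right-hand side of the exchange relation for the core determinant of a band pair. -/
def bandExchange {A : Type*} [CommRing A] (n k : ℕ) (a : ℕ → ℕ → A) (c : ℕ → A) : A :=
  a (k + 1) 1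
      * (sminor (stairCore n k (bandX n k a) (bandY n k a)) 2 ((k - 1) * (n - 1))) ^ k
    + ∑ i ∈ Finset.Icc 1 k,
        ((-1 : A) ^ (i * (n - 1)) * c i)
          * (∏ j ∈ Finset.Icc 2 n, a (k + 1) j) ^ (i - 1)
          * (sminor (stairCore n k (bandX n k a) (bandY n k a)) (n + 1)
              ((k - 1) * (n - 1))) ^ i
          * (sminor (stairCore n k (bandX n k a) (bandY n k a)) 2
              ((k - 1) * (n - 1))) ^ (k - i)

theorem sum_eq_det_of_detLM_eq {A : Type*} [CommRing A] [IsDomain A] {d k : ℕ}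
    (Xf Yf : ℕ → ℕ → A) (c : ℕ → A) (W : Matrix (Fin (d + k)) (Fin (d + k)) A)
    (hW : toSq _ Yf * W = 1) (hX : ∀ i j, j < d → Xf i j = 0)
    (hc : detLM (d + k) Xf Yf
        = (MvPolynomial.X 0 : MvPolynomial (Fin 2) A) ^ d
          * ∑ i ∈ Finset.range (k + 1), MvPolynomial.C (c i)
              * (MvPolynomial.X 1 : MvPolynomial (Fin 2) A) ^ i
              * (MvPolynomial.X 0 : MvPolynomial (Fin 2) A) ^ (k - i)) (l u : A) :
    ∑ i ∈ Finset.range (k + 1), c i * u ^ i * l ^ (k - i)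
      = (toSq (d + k) Yf).det * (l • (1 : Matrix (Fin k) (Fin k) A)
        - u • (-(W * toSq _ Xf)).submatrix (Fin.natAdd d) (Fin.natAdd d)).det := by
  have hWC : (toSq (d + k) Yf).map (fun p => (MvPolynomial.C p : MvPolynomial (Fin 2) A))
      * W.map (fun p => MvPolynomial.C p) = 1 := by
    have := Matrix.map_mul (L := toSq (d + k) Yf) (M := W)
      (f := (MvPolynomial.C : A →+* MvPolynomial (Fin 2) A))
    rw [hW] at this
    exact this.symm.trans (Matrix.map_one _ (map_zero _) (map_one _))
  have hXC : ∀ i j, (toSq (d + k) Xf).map (fun p => (MvPolynomial.C p : MvPolynomial (Fin 2) A))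
      i (Fin.castAdd k j) = 0 := by
    intro i j
    simp [toSq, hX]
  rw [detLM, det_smul_add_smul_of_cols_eq_zero hWC hXC, mul_left_comm] at hc
  have h1 := mul_left_cancel₀ (pow_ne_zero d (MvPolynomial.X_ne_zero (R := A) (0 : Fin 2))) hc
  have h2 := congrArg (MvPolynomial.eval ![l, u]) h1
  rw [map_mul, RingHom.map_det, RingHom.map_det] at h2
  have hY' : (MvPolynomial.eval ![l, u]).mapMatrix ((toSq (d + k) Yf).map fun p => MvPolynomial.C p)
      = toSq (d + k) Yf := by
    ext i j
    simp
  rw [hY'] at h2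
  simp only [map_sum, map_mul, map_pow, MvPolynomial.eval_C, MvPolynomial.eval_X] at h2
  simp only [Matrix.cons_val_zero, Matrix.cons_val_one] at h2
  rw [← h2]
  congr 2
  ext i j
  simp [Matrix.one_apply, Matrix.mul_apply, apply_ite]

theorem prod_mul_bandExchange {A : Type*} [CommRing A] {n k : ℕ} (a : ℕ → ℕ → A) (c : ℕ → A)
    (hc0 : c 0 = a (k + 1) 1 * ∏ j ∈ Finset.Icc 2 n, a (k + 1) j) :
    (∏ j ∈ Finset.Icc 2 n, a (k + 1) j) * bandExchange n k a c
      = ∑ i ∈ Finset.range (k + 1), c i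
          * ((-1) ^ (n - 1) * (∏ j ∈ Finset.Icc 2 n, a (k + 1) j)
            * sminor (stairCore n k (bandX n k a) (bandY n k a)) (n + 1) ((k - 1) * (n - 1))) ^ i
          * (sminor (stairCore n k (bandX n k a) (bandY n k a)) 2
              ((k - 1) * (n - 1))) ^ (k - i) := by
  unfold bandExchange
  generalize ∏ j ∈ Finset.Icc 2 n, a (k + 1) j = P at *
  rw [Finset.sum_range_succ', Finset.range_eq_Ico, ← Finset.Ico_add_one_right_eq_Icc,
    ← Finset.sum_Ico_add' _ 0 k 1, mul_add, Finset.mul_sum, add_comm, hc0]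
  congr 1
  · refine Finset.sum_congr rfl fun i _ => ?_
    rw [Nat.add_sub_cancel, mul_pow, mul_pow, ← pow_mul, mul_comm (n - 1)]
    ring
  · simp
    ring

theorem core_dvd_of_isUnit {A : Type*} [CommRing A] [IsDomain A] {m d : ℕ} (hd : 0 < d)
    (a : ℕ → ℕ → A) (c : ℕ → A)
    (hc : detLM (d + (m + 3)) (bandX (d + (m + 3)) (m + 3) a) (bandY (d + (m + 3)) (m + 3) a)
        = (MvPolynomial.X 0 : MvPolynomial (Fin 2) A) ^ d
          * ∑ i ∈ Finset.range (m + 3 + 1), MvPolynomial.C (c i)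
              * (MvPolynomial.X 1 : MvPolynomial (Fin 2) A) ^ i
              * (MvPolynomial.X 0 : MvPolynomial (Fin 2) A) ^ (m + 3 - i))
    (hu : IsUnit (∏ j ∈ Finset.Icc 1 (d + (m + 3)), a (m + 3 + 1) j))
    (hne : sminor (stairCore (d + (m + 3)) (m + 3) (bandX (d + (m + 3)) (m + 3) a)
      (bandY (d + (m + 3)) (m + 3) a)) 1 ((m + 3 - 1) * (d + (m + 3) - 1)) ≠ 0) :
    sminor (stairCore (d + (m + 3)) (m + 3) (bandX (d + (m + 3)) (m + 3) a)
      (bandY (d + (m + 3)) (m + 3) a)) 1 ((m + 3 - 1) * (d + (m + 3) - 1))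
      ∣ a 1 1 * bandExchange (d + (m + 3)) (m + 3) a c := by
  have hM : (m + 3 - 1) * (d + (m + 3) - 1) = (m + 2) * (d + m + 2) := rfl
  set Xf := bandX (d + (m + 3)) (m + 3) a with hXf
  set Yf := bandY (d + (m + 3)) (m + 3) a with hYf
  have hdetY : (toSq (d + (m + 3)) Yf).det
      = ∏ j ∈ Finset.Icc 1 (d + (m + 3)), a (m + 3 + 1) j :=
    det_bandY_trailing (s := 0) rfl a
  have hsplit : ∏ j ∈ Finset.Icc 1 (d + (m + 3)), a (m + 3 + 1) j
      = a (m + 3 + 1) 1 * ∏ j ∈ Finset.Icc 2 (d + (m + 3)), a (m + 3 + 1) j := by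
    rw [← Finset.Ico_add_one_right_eq_Icc, ← Finset.Ico_add_one_right_eq_Icc,
      Finset.prod_eq_prod_Ico_succ_bot (by omega)]
  have hW : toSq _ Yf * (toSq (d + (m + 3)) Yf)⁻¹ = 1 :=
    Matrix.mul_nonsing_inv _ (by rw [hdetY]; exact hu)
  have hX0 : ∀ i j, j < d → Xf i j = 0 := by
    intro i j hj
    rw [hXf, bandX, if_neg (by omega)]
  have hX1 : ∀ i, i ≠ 0 → Xf i d = 0 := by
    intro i hi
    rw [hXf, bandX, if_neg (by omega)]
  have hX00 : Xf 0 d = a 1 1 := by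
    rw [hXf, bandX, if_pos (by omega)]
    congr 1
    omega
  have hY0 : ∀ j, j ≠ 0 → Yf 0 j = 0 := by
    intro j hj
    rw [hYf, bandY, if_neg (by omega)]
  have hev := sum_eq_det_of_detLM_eq Xf Yf c _ hW hX0 hc
  have hc0 : c 0 = a (m + 3 + 1) 1 * ∏ j ∈ Finset.Icc 2 (d + (m + 3)), a (m + 3 + 1) j := by
    have := hev 1 0
    rw [Finset.sum_range_succ'] at this
    simpa [hdetY, hsplit] using this
  have hpos : 0 < (m + 2) * (d + m + 2) := by positivity
  have hlt : d + m + 2 < (m + 2) * (d + m + 2) := by nlinarith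
  have hdet : sminor (stairCore (d + (m + 3)) (m + 3) Xf Yf) 1 ((m + 2) * (d + m + 2))
      = (Matrix.of fun r c : Fin ((m + 2) * (d + m + 2)) =>
          stairCore (d + (m + 3)) (m + 3) Xf Yf r c).det := by
    rw [sminor_eq_det _ (Nat.add_sub_cancel _ 1)]
    simp
  have h01 := adjugate_zero_eq_sminor_of_zero (q := d + m + 2)
    (stairCore (d + (m + 3)) (m + 3) Xf Yf) ⟨0, hpos⟩ ⟨d + m + 2, hlt⟩ rfl rfl (by
      intro r c hr hc
      rw [stairCore_of_lt (by omega) _ _ hr, if_neg (by omega)])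
  have hbar : (Matrix.of fun r c : Fin (d + m + 2) =>
      stairCore (d + (m + 3)) (m + 3) Xf Yf r (c + 1)).det
      = ∏ j ∈ Finset.Icc 2 (d + (m + 3)), a (m + 3 + 1) j := by
    refine Eq.trans ?_
      (det_bandY_trailing (n := d + (m + 3)) (k := m + 3) (q := d + m + 2) (s := 1) rfl a)
    congr 1
    ext r c
    have hr := r.isLt
    have hc := c.isLt
    simp only [Matrix.of_apply]
    rw [stairCore_of_lt (by omega) _ _ hr, if_pos (by omega)]
  have hdvd := stairCore_det_dvd Xf Yf _ hW hX0 hX1 hY0 _ rfl (by rwa [← hdet]) ⟨0, hpos⟩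
    ⟨d + m + 2, hlt⟩ rfl rfl
  rw [h01, hbar, adjugate_zero_zero_eq_sminor _ _ rfl, ← hdet, hX00] at hdvd
  have hex := prod_mul_bandExchange a c hc0
  have hubar : IsUnit (∏ j ∈ Finset.Icc 2 (d + (m + 3)), a (m + 3 + 1) j) :=
    isUnit_of_mul_isUnit_right (hsplit ▸ hu)
  rw [← hubar.dvd_mul_left, mul_left_comm, hex, hM]
  have hfin := (hev (sminor (stairCore (d + (m + 3)) (m + 3) Xf Yf) 2 ((m + 2) * (d + m + 2)))
    ((-1) ^ (d + m + 2) * (∏ j ∈ Finset.Icc 2 (d + (m + 3)), a (m + 3 + 1) j)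
      * sminor (stairCore (d + (m + 3)) (m + 3) Xf Yf) (d + m + 2 + 2) ((m + 2) * (d + m + 2))))
  have hgoal := hdvd.mul_left (toSq (d + (m + 3)) Yf).det
  rw [mul_left_comm, ← hfin] at hgoal
  exact hgoal

section Map

variable {R S : Type*} [CommRing R] [CommRing S] (φ : R →+* S)

theorem map_sminor (f : ℕ → ℕ → R) (i M : ℕ) :
    φ (sminor f i M) = sminor (fun r c => φ (f r c)) i M := by
  rw [sminor, RingHom.map_det]
  rfl

theorem map_stairCore (n k : ℕ) (Xf Yf : ℕ → ℕ → R) (r c : ℕ) :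
    φ (stairCore n k Xf Yf r c)
      = stairCore n k (fun i j => φ (Xf i j)) (fun i j => φ (Yf i j)) r c := by
  simp only [stairCore, apply_ite φ, map_zero]

theorem map_bandX (n k : ℕ) (a : ℕ → ℕ → R) (i j : ℕ) :
    φ (bandX n k a i j) = bandX n k (fun i j => φ (a i j)) i j := by
  simp only [bandX, apply_ite φ, map_zero]

theorem map_bandY (n k : ℕ) (a : ℕ → ℕ → R) (i j : ℕ) :
    φ (bandY n k a i j) = bandY n k (fun i j => φ (a i j)) i j := by
  simp only [bandY, apply_ite φ, map_zero]

theorem map_bandCore_sminor (n k : ℕ) (a : ℕ → ℕ → R) (i M : ℕ) :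
    φ (sminor (stairCore n k (bandX n k a) (bandY n k a)) i M)
      = sminor (stairCore n k (bandX n k fun i j => φ (a i j)) (bandY n k fun i j => φ (a i j)))
          i M := by
  simp only [map_sminor, map_stairCore, map_bandX, map_bandY]

theorem map_bandExchange (n k : ℕ) (a : ℕ → ℕ → R) (c : ℕ → R) :
    φ (bandExchange n k a c) = bandExchange n k (fun i j => φ (a i j)) fun i => φ (c i) := by
  simp only [bandExchange, map_add, map_mul, map_pow, map_sum, map_prod, map_neg, map_one,
    map_bandCore_sminor]

theorem map_detLM (n : ℕ) (Xf Yf : ℕ → ℕ → R) :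
    MvPolynomial.map φ (detLM n Xf Yf)
      = detLM n (fun i j => φ (Xf i j)) fun i j => φ (Yf i j) := by
  rw [detLM, RingHom.map_det, detLM]
  congr 1
  ext i j : 1
  simp [toSq]

end Map

theorem core_dvd_pow_mul {R : Type*} [CommRing R] [IsDomain R] {m d : ℕ} (hd : 0 < d)
    (a : ℕ → ℕ → R) (c : ℕ → R)
    (hc : detLM (d + (m + 3)) (bandX (d + (m + 3)) (m + 3) a) (bandY (d + (m + 3)) (m + 3) a)
        = (MvPolynomial.X 0 : MvPolynomial (Fin 2) R) ^ d
          * ∑ i ∈ Finset.range (m + 3 + 1), MvPolynomial.C (c i)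
              * (MvPolynomial.X 1 : MvPolynomial (Fin 2) R) ^ i
              * (MvPolynomial.X 0 : MvPolynomial (Fin 2) R) ^ (m + 3 - i))
    (hD : ∏ j ∈ Finset.Icc 1 (d + (m + 3)), a (m + 3 + 1) j ≠ 0)
    (hne : sminor (stairCore (d + (m + 3)) (m + 3) (bandX (d + (m + 3)) (m + 3) a)
      (bandY (d + (m + 3)) (m + 3) a)) 1 ((m + 3 - 1) * (d + (m + 3) - 1)) ≠ 0) :
    ∃ N : ℕ, sminor (stairCore (d + (m + 3)) (m + 3) (bandX (d + (m + 3)) (m + 3) a)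
      (bandY (d + (m + 3)) (m + 3) a)) 1 ((m + 3 - 1) * (d + (m + 3) - 1))
      ∣ (∏ j ∈ Finset.Icc 1 (d + (m + 3)), a (m + 3 + 1) j) ^ N
        * (a 1 1 * bandExchange (d + (m + 3)) (m + 3) a c) := by
  set D := ∏ j ∈ Finset.Icc 1 (d + (m + 3)), a (m + 3 + 1) j with hDdef
  let A := Localization.Away D
  have hle : Submonoid.powers D ≤ nonZeroDivisors R :=
    powers_le_nonZeroDivisors_of_noZeroDivisors hD
  have : IsDomain A := IsLocalization.isDomain_localization hle
  let φ : R →+* A := algebraMap R A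
  have hinj : Function.Injective φ := IsLocalization.injective A hle
  have hcA := congrArg (MvPolynomial.map φ) hc
  rw [map_detLM] at hcA
  simp only [map_mul, map_pow, map_sum, MvPolynomial.map_X, MvPolynomial.map_C, map_bandX,
    map_bandY] at hcA
  have hu : IsUnit (∏ j ∈ Finset.Icc 1 (d + (m + 3)), φ (a (m + 3 + 1) j)) := by
    rw [← map_prod]
    exact IsLocalization.Away.algebraMap_isUnit D
  have h := core_dvd_of_isUnit hd (fun i j => φ (a i j)) (fun i => φ (c i)) hcA hu (by
    rw [← map_bandCore_sminor]
    exact (map_ne_zero_iff φ hinj).mpr hne)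
  rw [← map_bandCore_sminor, ← map_bandExchange, ← map_mul] at h
  obtain ⟨q, hq⟩ := h
  obtain ⟨x, ⟨_, N, rfl⟩, hx⟩ := IsLocalization.exists_mk'_eq (Submonoid.powers D) q
  refine ⟨N, x, hinj ?_⟩
  rw [map_mul, hq, map_mul, ← hx]
  rw [mul_left_comm]
  congr 1
  exact IsLocalization.mk'_spec' A x _

theorem det_ne_zero_of_entry_sq {N : ℕ} (M : Matrix (Fin N) (Fin N) (Polynomial ℂ)) (e : Fin N → ℤ)
    (he : StrictMono e)
    (h : ∀ i j, M i j = 0 ∨ ∃ s : ℕ, (s : ℤ) = (j : ℕ) - e i ∧ M i j = Polynomial.X ^ (s ^ 2))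
    (hd : ∀ i, M i i ≠ 0) : M.det ≠ 0 := by
  have hd' : ∀ i : Fin N, ∃ s : ℕ, (s : ℤ) = (i : ℕ) - e i ∧ M i i = Polynomial.X ^ (s ^ 2) :=
    fun i => (h i i).resolve_left (hd i)
  choose s hs hMs using hd'
  have key : ∀ σ : Equiv.Perm (Fin N), σ ≠ 1 →
      (∏ i, M i (σ i)).coeff (∑ i, s i ^ 2) = 0 := by
    intro σ hσ
    by_cases h0 : ∃ i, M i (σ i) = 0
    · obtain ⟨i, hi⟩ := h0
      rw [Finset.prod_eq_zero (Finset.mem_univ i) hi, Polynomial.coeff_zero]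
    · push Not at h0
      have hσ' := fun i => (h i (σ i)).resolve_left (h0 i)
      choose t ht hMt using hσ'
      rw [Finset.prod_congr rfl fun i _ => hMt i, Finset.prod_pow_eq_pow_sum, Polynomial.coeff_X_pow,
        if_neg]
      have hmono : Monovary (fun i : Fin N => ((i : ℕ) : ℤ)) e := by
        intro i j hij
        have := he.lt_iff_lt.mp hij
        simp only [Nat.cast_le]
        exact this.le
      have hlt : ∑ i, ((σ i : ℕ) : ℤ) * e i < ∑ i : Fin N, ((i : ℕ) : ℤ) * e i := by
        refine hmono.sum_comp_perm_mul_lt_sum_mul_iff.mpr fun hm => hσ ?_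
        have hσm : Monotone σ := by
          intro i j hij
          rcases hij.eq_or_lt with rfl | hij
          · exact le_rfl
          · have := hm (he hij)
            simpa using this
        exact (Equiv.Perm.monotone_iff σ).mp hσm
      have hsq : ∑ i, ((σ i : ℕ) : ℤ) ^ 2 = ∑ i : Fin N, ((i : ℕ) : ℤ) ^ 2 :=
        Equiv.sum_comp σ fun i : Fin N => ((i : ℕ) : ℤ) ^ 2
      intro heq
      have h1 : ∑ i, ((s i : ℤ)) ^ 2 = ∑ i, ((t i : ℤ)) ^ 2 := by exact_mod_cast heq
      simp only [hs, ht, sub_sq, Finset.sum_add_distrib, Finset.sum_sub_distrib, mul_assoc,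
        ← Finset.mul_sum] at h1
      linarith
  intro hdet
  rw [← Matrix.det_transpose, Matrix.det_apply'] at hdet
  have hc := congrArg (fun p => Polynomial.coeff p (∑ i, s i ^ 2)) hdet
  simp only [Matrix.transpose_apply, Polynomial.finsetSum_coeff, Polynomial.coeff_zero] at hc
  rw [Finset.sum_eq_single 1] at hc
  · simp [hMs, Finset.prod_pow_eq_pow_sum] at hc
  · intro σ _ hσ
    rw [Polynomial.coeff_intCast_mul, key σ hσ, mul_zero]
  · simp


theorem stairCore_band_eq {A : Type*} [Zero A] {q k r c : ℕ} (b : ℕ → A) (hk : k ≤ q + 1)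
    (hr : r < (k - 1) * q) :
    stairCore (q + 1) k (bandX (q + 1) k fun s _ => b s) (bandY (q + 1) k fun s _ => b s) r c = 0 ∨
    ∃ s, s + (r + r / q) = k + c ∧
      stairCore (q + 1) k (bandX (q + 1) k fun s _ => b s) (bandY (q + 1) k fun s _ => b s) r c
        = b s := by
  have h1 := Nat.div_add_mod r q
  simp only [stairCore, Nat.add_sub_cancel, if_pos hr]
  generalize r / q = j at *
  generalize r % q = i at *
  split_ifs with h2 h3
  · have h4 : j * (q + 1) = q * j + j := by ring
    simp only [bandY]
    split_ifs with h5
    · right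
      exact ⟨_, by omega, rfl⟩
    · exact Or.inl rfl
  · obtain ⟨t, rfl⟩ : ∃ t, j = t + 1 := ⟨j - 1, by omega⟩
    rw [Nat.add_sub_cancel] at *
    have h4 : (t + 1) * (q + 1) = t * (q + 1) + q + 1 := by ring
    have h6 : q * (t + 1) + t = t * (q + 1) + q := by ring
    simp only [bandX]
    split_ifs with h5
    · right
      exact ⟨_, by omega, rfl⟩
    · exact Or.inl rfl
  · exact Or.inl rfl

theorem stairCore_band_diag {A : Type*} [Zero A] {q k r : ℕ} (b : ℕ → A) (hk : k ≤ q)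
    (hr : r < (k - 1) * q) :
    stairCore (q + 1) k (bandX (q + 1) k fun s _ => b s) (bandY (q + 1) k fun s _ => b s) r r
      = b (k - r / q) := by
  have h1 := Nat.div_add_mod r q
  have hq : 0 < q := Nat.pos_of_ne_zero fun h => by simp [h] at hr
  have h2 := Nat.mod_lt r hq
  have h3 : r / q < k - 1 := Nat.div_lt_of_lt_mul (lt_of_lt_of_eq hr (mul_comm _ _))
  simp only [stairCore, Nat.add_sub_cancel, if_pos hr]
  generalize r / q = j at *
  generalize r % q = i at *
  have h4 : j * (q + 1) = q * j + j := by ring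
  by_cases hij : j ≤ i
  · rw [if_pos (by omega), bandY, if_pos (by omega)]
    congr 1
    omega
  · obtain ⟨t, rfl⟩ : ∃ t, j = t + 1 := ⟨j - 1, by omega⟩
    have h6 : q * (t + 1) + t = t * (q + 1) + q := by ring
    have h5 : (t + 1) * (q + 1) = t * (q + 1) + q + 1 := by ring
    rw [if_neg (by omega), Nat.add_sub_cancel, if_pos (by omega), bandX, if_pos (by omega)]
    congr 1
    omega

theorem bandCore_ne_zero {n k : ℕ} (hk : 2 ≤ k) (hn : k < n) :
    sminor (stairCore n k
        (bandX n k fun s _ => if 2 ≤ s ∧ s ≤ k then (Polynomial.X : Polynomial ℂ) ^ (s ^ 2) else 0)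
        (bandY n k fun s _ => if 2 ≤ s ∧ s ≤ k then (Polynomial.X : Polynomial ℂ) ^ (s ^ 2) else 0))
      1 ((k - 1) * (n - 1)) ≠ 0 := by
  obtain ⟨q, rfl⟩ : ∃ q, n = q + 1 := ⟨n - 1, by omega⟩
  rw [Nat.add_sub_cancel, sminor_eq_det _ (Nat.add_sub_cancel _ 1)]
  refine det_ne_zero_of_entry_sq _ (fun i => ((i + i / q : ℕ) : ℤ) - k) ?_ ?_ ?_
  · intro i j hij
    have h1 : (i : ℕ) < j := hij
    have h2 := Nat.div_le_div_right (c := q) h1.le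
    simp only
    omega
  · intro i j
    simp only [Matrix.of_apply, Nat.sub_self, zero_add]
    rcases stairCore_band_eq (q := q) (k := k) (r := i) (c := j)
      (fun s => if 2 ≤ s ∧ s ≤ k then (Polynomial.X : Polynomial ℂ) ^ (s ^ 2) else 0)
      hn.le i.isLt with h | ⟨s, hs, h⟩
    · exact Or.inl h
    · rw [h]
      split_ifs
      · exact Or.inr ⟨s, by omega, rfl⟩
      · exact Or.inl rfl
  · intro i
    simp only [Matrix.of_apply, Nat.sub_self, zero_add]
    have h1 : (i : ℕ) / q < k - 1 :=
      Nat.div_lt_of_lt_mul (lt_of_lt_of_eq i.isLt (mul_comm _ _))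
    rw [stairCore_band_diag (q := q) (k := k) (r := i)
      (fun s => if 2 ≤ s ∧ s ≤ k then (Polynomial.X : Polynomial ℂ) ^ (s ^ 2) else 0)
      (by omega) i.isLt, if_pos ⟨Nat.le_sub_of_add_le (by linarith [Nat.lt_sub_iff_add_lt.mp h1]),
        Nat.sub_le _ _⟩]
    exact pow_ne_zero _ Polynomial.X_ne_zero

/-- The specialization `a_{si} ↦ t ^ (s ^ 2)` for `2 ≤ s ≤ k`, and `a_{si} ↦ 0` otherwise. -/
def bandSpecialization (k : ℕ) : Rband →+* Polynomial ℂ :=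
  (MvPolynomial.aeval fun p : ℕ × ℕ =>
    if 2 ≤ p.1 ∧ p.1 ≤ k then (Polynomial.X : Polynomial ℂ) ^ (p.1 ^ 2) else 0).toRingHom

theorem bandSpecialization_genA (k s i : ℕ) :
    bandSpecialization k (genA s i)
      = if 2 ≤ s ∧ s ≤ k then (Polynomial.X : Polynomial ℂ) ^ (s ^ 2) else 0 := by
  simp [bandSpecialization, genA]

theorem bandSpecialization_core_ne_zero {n k : ℕ} (hk : 2 ≤ k) (hn : k < n) :
    bandSpecialization k (sminor (stairCore n k (bandX n k genA) (bandY n k genA)) 1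
      ((k - 1) * (n - 1))) ≠ 0 := by
  rw [map_bandCore_sminor]
  simp only [bandSpecialization_genA]
  exact bandCore_ne_zero hk hn

theorem isRelPrime_core_genA {n k s i : ℕ} (hk : 2 ≤ k) (hn : k < n) (hs : ¬(2 ≤ s ∧ s ≤ k)) :
    IsRelPrime (sminor (stairCore n k (bandX n k genA) (bandY n k genA)) 1
      ((k - 1) * (n - 1))) (genA s i) := by
  have hp : Prime (genA s i) := MvPolynomial.X_prime
  rw [isRelPrime_comm, hp.irreducible.isRelPrime_iff_not_dvd]
  intro h
  refine bandSpecialization_core_ne_zero hk hn (zero_dvd_iff.mp ?_)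
  have := map_dvd (bandSpecialization k) h
  rwa [bandSpecialization_genA, if_neg hs] at this

/-- the generalized exchange relation for `φ̃_1` in the generic band
situation, `k > 2`. -/
theorem statement13 (n k : ℕ) (hk : 2 < k) (hn : k < n) (c : ℕ → Rband)
    (hc : detLM n (bandX n k genA) (bandY n k genA)
        = (MvPolynomial.X 0 : MvPolynomial (Fin 2) Rband) ^ (n - k)
          * ∑ i ∈ Finset.range (k + 1), MvPolynomial.C (c i)
              * (MvPolynomial.X 1 : MvPolynomial (Fin 2) Rband) ^ i
              * (MvPolynomial.X 0 : MvPolynomial (Fin 2) Rband) ^ (k - i)) :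
    ∃ φstar : Rband,
      sminor (stairCore n k (bandX n k genA) (bandY n k genA)) 1 ((k - 1) * (n - 1)) * φstar
        = genA (k + 1) 1
            * (sminor (stairCore n k (bandX n k genA) (bandY n k genA)) 2
                ((k - 1) * (n - 1))) ^ k
          + ∑ i ∈ Finset.Icc 1 k,
              ((-1 : Rband) ^ (i * (n - 1)) * c i)
                * (∏ j ∈ Finset.Icc 2 n, genA (k + 1) j) ^ (i - 1)
                * (sminor (stairCore n k (bandX n k genA) (bandY n k genA)) (n + 1)
                    ((k - 1) * (n - 1))) ^ i
                * (sminor (stairCore n k (bandX n k genA) (bandY n k genA)) 2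
                    ((k - 1) * (n - 1))) ^ (k - i) := by
  obtain ⟨m, rfl⟩ : ∃ m, k = m + 3 := ⟨k - 3, by omega⟩
  obtain ⟨d, rfl⟩ : ∃ d, n = d + (m + 3) := ⟨n - (m + 3), by omega⟩
  rw [Nat.add_sub_cancel] at hc
  have hprod : ∏ j ∈ Finset.Icc 1 (d + (m + 3)), genA (m + 3 + 1) j ≠ 0 :=
    Finset.prod_ne_zero_iff.mpr fun j _ => MvPolynomial.X_ne_zero _
  have hne := bandSpecialization_core_ne_zero (show 2 ≤ m + 3 by omega) hn
  obtain ⟨N, hN⟩ := core_dvd_pow_mul (by omega) genA c hc hprod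
    fun h => hne (by rw [h, map_zero])
  have h1 := (IsRelPrime.pow_right (IsRelPrime.prod_right fun j _ =>
    isRelPrime_core_genA (by omega) hn (by omega))).dvd_of_dvd_mul_left hN
  exact ((isRelPrime_core_genA (by omega) hn (by omega)).dvd_of_dvd_mul_left h1).imp
    fun _ h => h.symm

end
end

section
/- In the generic band situation, for every 1 ≤ t ≤ (k−1)(n−1) the trailing minor φ̃_t is an irreducible element of the polynomial ring R. -/
open Matrix Finset

noncomputable section

/-! ### Weighted homogeneous factors and killing variables -/

section Killing

variable {σ : Type*}

/-- The grading homomorphism `X v ↦ X v * T ^ w v` into polynomials in one more variable `T`. -/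
def weightHom (w : σ → ℕ) : MvPolynomial σ ℂ →+* Polynomial (MvPolynomial σ ℂ) :=
  MvPolynomial.eval₂Hom (Polynomial.C.comp MvPolynomial.C)
    fun v => Polynomial.C (MvPolynomial.X v) * Polynomial.X ^ w v

theorem weightHom_monomial (w : σ → ℕ) (d : σ →₀ ℕ) (a : ℂ) :
    weightHom w (MvPolynomial.monomial d a) =
      Polynomial.C (MvPolynomial.monomial d a) * Polynomial.X ^ Finsupp.weight w d := by
  classical
  rw [weightHom, MvPolynomial.coe_eval₂Hom, MvPolynomial.eval₂_monomial,
    MvPolynomial.monomial_eq, Finsupp.weight_apply]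
  simp only [mul_pow, Finsupp.prod, Finsupp.sum, Finset.prod_mul_distrib, map_mul, map_prod,
    map_pow, RingHom.comp_apply, ← pow_mul, smul_eq_mul]
  rw [Finset.prod_pow_eq_pow_sum, mul_assoc]
  simp only [mul_comm]

theorem coeff_coeff_weightHom (w : σ → ℕ) (p : MvPolynomial σ ℂ) (d : σ →₀ ℕ) (e : ℕ) :
    ((weightHom w p).coeff e).coeff d = if Finsupp.weight w d = e then p.coeff d else 0 := by
  classical
  induction p using MvPolynomial.induction_on' with
  | monomial u a =>
    rw [weightHom_monomial, Polynomial.coeff_C_mul_X_pow]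
    by_cases hu : u = d
    · subst hu
      by_cases he : e = Finsupp.weight w u
      · simp [he]
      · simp [he, Ne.symm he]
    · by_cases he : e = Finsupp.weight w u <;> simp [he, MvPolynomial.coeff_monomial, hu]
  | add p q hp hq =>
    rw [map_add, Polynomial.coeff_add, MvPolynomial.coeff_add, hp, hq, MvPolynomial.coeff_add]
    split_ifs <;> simp

theorem weightHom_of_isWeightedHomogeneous {w : σ → ℕ} {p : MvPolynomial σ ℂ} {n : ℕ}
    (hp : p.IsWeightedHomogeneous w n) :
    weightHom w p = Polynomial.C p * Polynomial.X ^ n := by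
  ext e d
  rw [coeff_coeff_weightHom, Polynomial.coeff_C_mul_X_pow]
  by_cases h : p.coeff d = 0
  · split_ifs <;> simp [h]
  · rw [hp h]
    by_cases he : n = e
    · simp [he]
    · simp [he, Ne.symm he]

theorem weightHom_injective (w : σ → ℕ) : Function.Injective (weightHom w) := by
  intro p q h
  ext d
  have hp := coeff_coeff_weightHom w p d (Finsupp.weight w d)
  rw [h, coeff_coeff_weightHom] at hp
  simpa using hp.symm

/-- A factor of a nonzero weighted homogeneous polynomial is weighted homogeneous. -/
theorem exists_isWeightedHomogeneous_of_mul {w : σ → ℕ} {p q : MvPolynomial σ ℂ} {n : ℕ}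
    (h : (p * q).IsWeightedHomogeneous w n) (h0 : p * q ≠ 0) :
    ∃ e, p.IsWeightedHomogeneous w e := by
  have hp : weightHom w p ≠ 0 := fun h' =>
    left_ne_zero_of_mul h0 (weightHom_injective w (by rw [h', map_zero]))
  have hq : weightHom w q ≠ 0 := fun h' =>
    right_ne_zero_of_mul h0 (weightHom_injective w (by rw [h', map_zero]))
  have hpq := weightHom_of_isWeightedHomogeneous h
  rw [map_mul] at hpq
  have h1 := Polynomial.natDegree_mul hp hq
  have h2 := Polynomial.natTrailingDegree_mul hp hq
  rw [hpq, Polynomial.natDegree_C_mul_X_pow _ _ h0] at h1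
  rw [hpq, Polynomial.C_mul_X_pow_eq_monomial, Polynomial.natTrailingDegree_monomial h0] at h2
  have h3 := Polynomial.natTrailingDegree_le_natDegree (weightHom w p)
  have h4 := Polynomial.natTrailingDegree_le_natDegree (weightHom w q)
  refine ⟨(weightHom w p).natDegree, fun {d} hd => ?_⟩
  have hc : (weightHom w p).coeff (Finsupp.weight w d) ≠ 0 := by
    intro h'
    have := coeff_coeff_weightHom w p d (Finsupp.weight w d)
    rw [h'] at this
    simp only [MvPolynomial.coeff_zero, if_true] at this
    exact hd this.symm
  have h5 := Polynomial.le_natDegree_of_ne_zero hc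
  have h6 := Polynomial.natTrailingDegree_le_of_ne_zero hc
  omega

open Classical in
/-- The homomorphism setting the variables outside `S` to zero. -/
def restrictVars (S : Set σ) : MvPolynomial σ ℂ →ₐ[ℂ] MvPolynomial σ ℂ :=
  MvPolynomial.aeval fun v => if v ∈ S then MvPolynomial.X v else 0

theorem restrictVars_X_of_mem {S : Set σ} {v : σ} (hv : v ∈ S) :
    restrictVars S (MvPolynomial.X v) = MvPolynomial.X v := by
  simp [restrictVars, hv]

theorem restrictVars_X_of_notMem {S : Set σ} {v : σ} (hv : v ∉ S) :
    restrictVars S (MvPolynomial.X v) = 0 := by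
  simp [restrictVars, hv]

theorem coeff_restrictVars {S : Set σ} {d : σ →₀ ℕ} (hd : ∀ v ∈ d.support, v ∈ S)
    (p : MvPolynomial σ ℂ) : (restrictVars S p).coeff d = p.coeff d := by
  classical
  induction p using MvPolynomial.induction_on' with
  | monomial u a =>
    by_cases hu : ∀ v ∈ u.support, v ∈ S
    · congr 1
      rw [restrictVars, MvPolynomial.aeval_monomial, MvPolynomial.monomial_eq,
        MvPolynomial.algebraMap_eq]
      congr 1
      exact Finset.prod_congr rfl fun v hv => by simp [hu v hv]
    · have hne : u ≠ d := fun h => hu (h ▸ hd)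
      push Not at hu
      obtain ⟨v, hv, hvS⟩ := hu
      rw [restrictVars, MvPolynomial.aeval_monomial, Finsupp.prod,
        Finset.prod_eq_zero hv, mul_zero, MvPolynomial.coeff_zero, MvPolynomial.coeff_monomial,
        if_neg hne]
      rw [if_neg hvS, zero_pow (Finsupp.mem_support_iff.mp hv)]
  | add p q hp hq => rw [map_add, MvPolynomial.coeff_add, hp, hq, MvPolynomial.coeff_add]

/-- A weighted homogeneous polynomial of positive weights is constant as soon as it becomes a
unit after setting some variables to zero. -/
theorem isUnit_of_isUnit_restrictVars {w : σ → ℕ} (hw : ∀ v, w v ≠ 0) {S : Set σ}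
    {p : MvPolynomial σ ℂ} {e : ℕ} (hp : p.IsWeightedHomogeneous w e)
    (hu : IsUnit (restrictVars S p)) : IsUnit p := by
  have h0 : p.coeff 0 ≠ 0 := by
    rw [← coeff_restrictVars (S := S) (by simp)]
    exact (MvPolynomial.isUnit_iff.mp hu).1.ne_zero
  have he : e = 0 := by simpa using (hp h0).symm
  refine MvPolynomial.isUnit_iff.mpr ⟨h0.isUnit, fun d hd => ?_⟩
  rw [isNilpotent_iff_eq_zero]
  by_contra hc
  have := hp hc
  rw [he, Finsupp.weight_apply, Finsupp.sum, Finset.sum_eq_zero_iff] at this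
  refine hd (Finsupp.ext fun v => ?_)
  by_contra hv
  have := this v (Finsupp.mem_support_iff.mpr hv)
  simp only [smul_eq_mul, mul_eq_zero] at this
  exact this.elim hv (hw v)

/-- If all weights lie in `[n, 2 * n)` and the weight of `x ∈ S` differs from those of the variables
outside `S`, a weighted homogeneous polynomial which restricts to a unit multiple of `x` is
divisible by `x`. -/
theorem X_dvd_of_restrictVars_eq {w : σ → ℕ} {n : ℕ} (hw : ∀ v, n ≤ w v)
    {S : Set σ} {x : σ} (hxS : x ∈ S) (hx : w x < 2 * n) (hwx : ∀ v ∉ S, w v ≠ w x)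
    {p u : MvPolynomial σ ℂ} {e : ℕ} (hp : p.IsWeightedHomogeneous w e) (hu : IsUnit u)
    (h : restrictVars S p = MvPolynomial.X x * u) : MvPolynomial.X x ∣ p := by
  classical
  obtain ⟨c, hc, rfl⟩ := MvPolynomial.isUnit_iff_eq_C_of_isReduced.mp hu
  have hS : ∀ v ∈ S, p.coeff (Finsupp.single v 1) = if v = x then c else 0 := by
    intro v hv
    rw [← coeff_restrictVars (S := S), h, mul_comm, MvPolynomial.coeff_C_mul,
      MvPolynomial.coeff_X]
    · simp [Finsupp.single_left_inj, eq_comm]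
    · intro v' hv'
      rw [Finsupp.mem_support_iff, Finsupp.single_apply] at hv'
      have : v = v' := by by_contra h; simp [h] at hv'
      exact this ▸ hv
  have he : e = w x := by
    have h1 : p.coeff (Finsupp.single x 1) ≠ 0 := by
      rw [hS x hxS, if_pos rfl]; exact hc.ne_zero
    simpa [Finsupp.weight_apply] using (hp h1).symm
  have hsupp : ∀ d, p.coeff d ≠ 0 → d = Finsupp.single x 1 := by
    intro d hd
    have hwt := hp hd
    have hle : n * d.degree ≤ Finsupp.weight w d := by
      rw [Finsupp.weight_apply, Finsupp.degree_apply, Finsupp.sum, Finset.mul_sum]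
      refine Finset.sum_le_sum fun v _ => ?_
      rw [smul_eq_mul, mul_comm]
      exact Nat.mul_le_mul_left _ (hw v)
    have hdeg : d.degree < 2 := by
      by_contra h2
      have := Nat.mul_le_mul_left n (not_lt.mp h2)
      omega
    have hd0 : d.degree ≠ 0 := by
      intro h0
      rw [Finsupp.degree_eq_zero_iff] at h0
      subst h0
      have := hw x
      simp at hwt
      omega
    obtain ⟨v, rfl⟩ : ∃ v, d = Finsupp.single v 1 :=
      (Finsupp.sum_eq_one_iff d).mp (show d.degree = 1 by omega)
    have hwv : w v = w x := by simpa [Finsupp.weight_apply, he] using hwt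
    by_contra hne
    by_cases hv : v ∈ S
    · rw [hS v hv] at hd
      exact hne (by rw [show v = x by by_contra h; simp [h] at hd])
    · exact hwx v hv hwv
  rw [MvPolynomial.X_dvd_iff_modMonomial_eq_zero]
  ext d
  by_cases hd : Finsupp.single x 1 ≤ d
  · rw [MvPolynomial.coeff_modMonomial_of_le _ hd, MvPolynomial.coeff_zero]
  · rw [MvPolynomial.coeff_modMonomial_of_not_le _ hd, MvPolynomial.coeff_zero]
    by_contra hc
    exact hd (hsupp d hc ▸ le_rfl)

end Killing

/-! ### Determinants with sparse top rows -/

theorem det_eq_of_first_row {α : Type*} [CommRing α] {L : ℕ}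
    (M : Matrix (Fin (L + 1)) (Fin (L + 1)) α) (h : ∀ j : Fin L, M 0 j.succ = 0) :
    M.det = M 0 0 * (M.submatrix Fin.succ Fin.succ).det := by
  rw [Matrix.det_succ_row_zero, Fin.sum_univ_succ]
  simp [h]

theorem det_eq_of_first_two_rows {α : Type*} [CommRing α] {L : ℕ}
    (M : Matrix (Fin (L + 2)) (Fin (L + 2)) α) (h0 : ∀ j, j ≠ 1 → M 0 j = 0)
    (h1 : ∀ j, j ≠ 0 → M 1 j = 0) :
    M.det = -(M 0 1 * (M 1 0 * (M.submatrix (fun i : Fin L => i.succ.succ)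
      fun j : Fin L => j.succ.succ).det)) := by
  have hs : ∀ j : Fin L, Equiv.swap (0 : Fin (L + 2)) 1 j.succ.succ = j.succ.succ := fun j =>
    Equiv.swap_apply_of_ne_of_ne (Fin.succ_ne_zero _)
      (fun h => Fin.succ_ne_zero j (Fin.succ_injective _ h))
  have key := Matrix.det_permute' (Equiv.swap (0 : Fin (L + 2)) 1) M
  rw [Equiv.Perm.sign_swap (by simp), det_eq_of_first_row, det_eq_of_first_row] at key
  · simp only [Matrix.submatrix_apply, Matrix.submatrix_submatrix, id,
      Equiv.swap_apply_left, Fin.succ_zero_eq_one, Equiv.swap_apply_right] at key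
    have e : (M.submatrix ((id ∘ Fin.succ) ∘ Fin.succ)
        ((Equiv.swap (0 : Fin (L + 2)) 1 ∘ Fin.succ) ∘ Fin.succ)) =
        M.submatrix (fun i : Fin L => i.succ.succ) fun j : Fin L => j.succ.succ := by
      ext i j
      simp [hs]
    simp only [e] at key
    rw [key]
    simp
  · intro j
    simp only [Matrix.submatrix_apply, id, hs]
    exact h1 _ (Fin.succ_ne_zero _)
  · intro j
    simp only [Matrix.submatrix_apply, id]
    refine h0 _ fun h => ?_
    have := congrArg (Equiv.swap (0 : Fin (L + 2)) 1) h
    rw [Equiv.swap_apply_self, Equiv.swap_apply_right] at this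
    exact Fin.succ_ne_zero _ this

/-! ### The band core with a restricted set of variables -/

open Classical in
/-- The entries of the core of the generic band pair, with the variables outside `S` set to
zero. -/
def bandEntry (n k : ℕ) (S : Set (ℕ × ℕ)) (r c : ℕ) : Rband :=
  if r + r / (n - 1) + 1 ≤ c + k ∧ c ≤ r + r / (n - 1) + 1 ∧
      (c + k - (r + r / (n - 1)), r % (n - 1) + 2) ∈ S then
    MvPolynomial.X (c + k - (r + r / (n - 1)), r % (n - 1) + 2)
  else 0

theorem bandEntry_eq_X {n k r c s : ℕ} {S : Set (ℕ × ℕ)} (h : s + (r + r / (n - 1)) = c + k)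
    (h1 : 1 ≤ s) (hs : s ≤ k + 1) (hS : (s, r % (n - 1) + 2) ∈ S) :
    bandEntry n k S r c = MvPolynomial.X (s, r % (n - 1) + 2) := by
  obtain rfl : s = c + k - (r + r / (n - 1)) := by omega
  exact if_pos ⟨by omega, by omega, hS⟩

theorem bandEntry_eq_zero {n k r c : ℕ} {S : Set (ℕ × ℕ)}
    (h : ∀ s, s + (r + r / (n - 1)) = c + k → s ≤ k + 1 → (s, r % (n - 1) + 2) ∉ S) :
    bandEntry n k S r c = 0 :=
  if_neg fun h' => h _ (by omega) (by omega) h'.2.2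

/-- The `L × L` principal minor of `bandEntry n k S` starting at row and column `t`. -/
def bandMinor (n k : ℕ) (S : Set (ℕ × ℕ)) (t L : ℕ) : Rband :=
  (Matrix.of fun i j : Fin L => bandEntry n k S (t + i) (t + j)).det

theorem stairCore_band_eq_bandEntry {n k r c : ℕ} (hk : 2 ≤ k) (hn : k < n)
    (hr : r < (k - 1) * (n - 1)) :
    stairCore n k (bandX n k genA) (bandY n k genA) r c = bandEntry n k Set.univ r c := by
  have hp : r % (n - 1) < n - 1 := Nat.mod_lt _ (by omega)
  have hrq : r + r / (n - 1) = r / (n - 1) * n + r % (n - 1) := by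
    have h1 := Nat.div_add_mod r (n - 1)
    obtain ⟨m, rfl⟩ : ∃ m, n = m + 1 := ⟨n - 1, by omega⟩
    simp only [Nat.add_sub_cancel] at *
    rw [mul_add, mul_comm _ m]
    omega
  have hq1 : 1 ≤ r / (n - 1) → (r / (n - 1) - 1) * n + n = r / (n - 1) * n := fun h => by
    obtain ⟨q, hq⟩ : ∃ q, r / (n - 1) = q + 1 := ⟨_, (Nat.sub_add_cancel h).symm⟩
    rw [hq, Nat.add_sub_cancel]; ring
  have hq0 : ¬ 1 ≤ r / (n - 1) → r / (n - 1) * n = 0 := fun h => by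
    rw [Nat.eq_zero_of_not_pos h, zero_mul]
  rw [stairCore, bandEntry, if_pos hr, hrq]
  generalize r / (n - 1) = q at *
  generalize hp' : r % (n - 1) = p at *
  generalize (q - 1) * n = z at *
  generalize q * n = y at *
  simp only [bandX, bandY, genA, Set.mem_univ, and_true]
  split_ifs <;> first
    | rfl
    | omega
    | (congr 2; omega)

theorem restrictVars_bandMinor (n k : ℕ) (S T : Set (ℕ × ℕ)) (t L : ℕ) :
    restrictVars T (bandMinor n k S t L) = bandMinor n k (S ∩ T) t L := by
  rw [bandMinor, AlgHom.map_det, bandMinor]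
  congr 1
  ext1 i j
  simp only [AlgHom.mapMatrix_apply, Matrix.map_apply, Matrix.of_apply, bandEntry]
  split_ifs with h1 h2 h2
  · exact restrictVars_X_of_mem h2.2.2.2
  · exact restrictVars_X_of_notMem fun h => h2 ⟨h1.1, h1.2.1, h1.2.2, h⟩
  · exact absurd ⟨h2.1, h2.2.1, h2.2.2.1⟩ h1
  · exact map_zero _

/-- A grading of the band variables for which every column of the core is homogeneous. -/
def colWeight (n k : ℕ) (v : ℕ × ℕ) : ℕ := n + if v.1 ≤ k + 1 then (v.1 + v.2) % n else n

theorem bandMinor_isWeightedHomogeneous {n k : ℕ} (hn : 0 < n) (S : Set (ℕ × ℕ)) (t L : ℕ) :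
    (bandMinor n k S t L).IsWeightedHomogeneous (colWeight n k)
      (∑ j : Fin L, (n + (t + j + k + 2) % n)) := by
  rw [bandMinor, Matrix.det_apply]
  refine (MvPolynomial.weightedHomogeneousSubmodule ℂ (colWeight n k) _).sum_mem fun σ _ => ?_
  rw [Units.smul_def]
  refine zsmul_mem ?_ _
  rw [MvPolynomial.mem_weightedHomogeneousSubmodule]
  refine MvPolynomial.IsWeightedHomogeneous.prod _ _ _ fun j _ => ?_
  simp only [Matrix.of_apply, bandEntry]
  split_ifs with h
  · convert! MvPolynomial.isWeightedHomogeneous_X ℂ (colWeight n k) _ using 1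
    rw [colWeight, if_pos (by dsimp only; omega)]
    congr 1
    generalize t + (σ j : ℕ) = r at *
    generalize t + (j : ℕ) = c at *
    have hrq : r + r / (n - 1) = n * (r / (n - 1)) + r % (n - 1) := by
      have h1 := Nat.div_add_mod r (n - 1)
      obtain ⟨m, rfl⟩ : ∃ m, n = m + 1 := ⟨n - 1, by omega⟩
      simp only [Nat.add_sub_cancel] at *
      rw [add_mul]
      omega
    rw [← Nat.add_mul_mod_self_left (c + k - (r + r / (n - 1)) + (r % (n - 1) + 2)) n
      (r / (n - 1))]
    congr 1
    omega
  · exact MvPolynomial.isWeightedHomogeneous_zero _ _ _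

/-- If the top row meets only its diagonal variable, the minor factors. -/
theorem bandMinor_succ {n k t L : ℕ} {S : Set (ℕ × ℕ)} (hq : t / (n - 1) + 1 ≤ k)
    (hd : (k - t / (n - 1), t % (n - 1) + 2) ∈ S)
    (hS : ∀ s, k - t / (n - 1) < s → s ≤ k + 1 → (s, t % (n - 1) + 2) ∉ S) :
    bandMinor n k S t (L + 1) =
      MvPolynomial.X (k - t / (n - 1), t % (n - 1) + 2) * bandMinor n k S (t + 1) L := by
  rw [bandMinor, det_eq_of_first_row]
  · congr 1
    · simp only [Matrix.of_apply, Fin.val_zero, add_zero]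
      exact bandEntry_eq_X (by omega) (by omega) ((Nat.sub_le _ _).trans k.le_succ) hd
    · rw [bandMinor]
      congr 1
      ext1 i j
      simp only [Matrix.submatrix_apply, Matrix.of_apply, Fin.val_succ]
      congr 1 <;> ring
  · intro j
    simp only [Matrix.of_apply, Fin.val_zero, add_zero, Fin.val_succ]
    exact bandEntry_eq_zero fun s h hs => hS s (by omega) hs

theorem bandMinor_ne_zero {n k N : ℕ} (hN : ∀ r < N, r / (n - 1) + 1 < k) {L : ℕ} :
    ∀ {t : ℕ} {S : Set (ℕ × ℕ)}, t + L = N →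
      (∀ r, t ≤ r → r < N → (k - r / (n - 1), r % (n - 1) + 2) ∈ S) →
      bandMinor n k S t L ≠ 0 := by
  induction L with
  | zero => intro t S _ _; simp [bandMinor]
  | succ L ih =>
    intro t S ht hS h0
    have hqt := hN t (by omega)
    let T : Set (ℕ × ℕ) := {v | v.2 = t % (n - 1) + 2 → v.1 ≤ k - t / (n - 1)}
    have h1 := congrArg (restrictVars T) h0
    rw [restrictVars_bandMinor, map_zero, bandMinor_succ (k := k) (S := S ∩ T) (by omega)
      ⟨hS t le_rfl (by omega), fun _ => le_rfl⟩
      (fun s hs _ h => absurd (h.2 rfl) (not_le.mpr hs))] at h1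
    refine mul_ne_zero (MvPolynomial.X_ne_zero _) (ih (by omega) fun r hr hrN => ?_) h1
    refine ⟨hS r (by omega) hrN, fun _ => ?_⟩
    have := Nat.div_le_div_right (c := n - 1) (show t ≤ r by omega)
    dsimp only
    omega

theorem div_lt_div_of_mod_eq {m a b : ℕ} (hab : a < b) (h : b % m = a % m) : a / m < b / m := by
  have h1 := Nat.div_add_mod a m
  have h2 := Nat.div_add_mod b m
  by_contra hle
  have := Nat.mul_le_mul_left m (not_lt.mp hle)
  omega

/-- Without the variable at the top left corner the minor still contains the monomial which
transposes its first two rows. -/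
theorem bandMinor_diff_ne_zero {n k N L t : ℕ} {S : Set (ℕ × ℕ)}
    (hm : 2 ≤ n - 1) (hN : ∀ r < N, r / (n - 1) + 1 < k) (ht : t + (L + 2) = N)
    (hd : ∀ r, t ≤ r → r < N → (k - r / (n - 1), r % (n - 1) + 2) ∈ S)
    (hsup : (k - t / (n - 1) + 1, t % (n - 1) + 2) ∈ S)
    (hsub : (k - (t + 1) / (n - 1) - 1, (t + 1) % (n - 1) + 2) ∈ S) :
    bandMinor n k (S ∩ {(k - t / (n - 1), t % (n - 1) + 2)}ᶜ) t (L + 2) ≠ 0 := by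
  intro h0
  have hqt := hN t (by omega)
  have hqt1 := hN (t + 1) (by omega)
  have hmono := Nat.div_le_div_right (c := n - 1) (Nat.le_succ t)
  have hmod : (t + 1) % (n - 1) ≠ t % (n - 1) := by
    intro h
    have h1 := Nat.div_add_mod t (n - 1)
    have h2 := Nat.div_add_mod (t + 1) (n - 1)
    have h3 := Nat.mul_le_mul_left (n - 1) (div_lt_div_of_mod_eq (Nat.lt_succ_self t) h)
    rw [Nat.mul_succ] at h3
    rw [Nat.succ_eq_add_one] at h3
    omega
  let T : Set (ℕ × ℕ) := {v |
    (v.2 = t % (n - 1) + 2 → v.1 < k - t / (n - 1) ∨ v.1 = k - t / (n - 1) + 1) ∧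
    (v.2 = (t + 1) % (n - 1) + 2 → v.1 < k - (t + 1) / (n - 1))}
  have h1 := congrArg (restrictVars T) h0
  rw [restrictVars_bandMinor, map_zero, bandMinor, det_eq_of_first_two_rows] at h1
  · simp only [Matrix.of_apply, Fin.val_zero, add_zero, Fin.val_one] at h1
    rw [bandEntry_eq_X (s := k - t / (n - 1) + 1) (by omega) (by omega)
        (Nat.succ_le_succ (Nat.sub_le _ _)),
      bandEntry_eq_X (s := k - (t + 1) / (n - 1) - 1) (by omega) (by omega)
        (((Nat.sub_le _ _).trans (Nat.sub_le _ _)).trans k.le_succ),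
      neg_eq_zero] at h1
    · refine mul_ne_zero (MvPolynomial.X_ne_zero _) (mul_ne_zero (MvPolynomial.X_ne_zero _) ?_) h1
      have := bandMinor_ne_zero hN (t := t + 2) (L := L) (by omega)
        (S := S ∩ {(k - t / (n - 1), t % (n - 1) + 2)}ᶜ ∩ T) ?_
      · convert! this using 1
        rw [bandMinor]
        congr 1
        ext1 i j
        simp only [Matrix.submatrix_apply, Matrix.of_apply, Fin.val_succ]
        congr 1 <;> ring
      · intro r hr hrN
        have hqr := hN r hrN
        have ha : r % (n - 1) = t % (n - 1) → t / (n - 1) < r / (n - 1) :=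
          div_lt_div_of_mod_eq (by omega)
        have hb : r % (n - 1) = (t + 1) % (n - 1) → (t + 1) / (n - 1) < r / (n - 1) :=
          div_lt_div_of_mod_eq (by omega)
        refine ⟨⟨hd r (by omega) hrN, ?_⟩, ?_, ?_⟩
        · simp only [Set.mem_compl_iff, Set.mem_singleton_iff, Prod.mk.injEq]
          omega
        · dsimp only; omega
        · dsimp only; omega
    · refine ⟨⟨hsub, ?_⟩, ?_, ?_⟩
      · simp only [Set.mem_compl_iff, Set.mem_singleton_iff, Prod.mk.injEq]; omega
      · dsimp only; omega
      · dsimp only; omega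
    · refine ⟨⟨hsup, ?_⟩, ?_, ?_⟩
      · simp only [Set.mem_compl_iff, Set.mem_singleton_iff, Prod.mk.injEq]; omega
      · dsimp only; omega
      · dsimp only; omega
  · intro j hj
    have hj' : (j : ℕ) ≠ 1 := fun h => hj (Fin.ext (by simpa using h))
    simp only [Matrix.of_apply, Fin.val_zero, add_zero]
    refine bandEntry_eq_zero fun s hs _ h => ?_
    have h3 := h.1.2
    have h2 := h.2.1 rfl
    simp only [Set.mem_compl_iff, Set.mem_singleton_iff, Prod.mk.injEq, and_true] at h3
    dsimp only at h2
    omega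
  · intro j hj
    have hj' : (j : ℕ) ≠ 0 := fun h => hj (Fin.ext (by simpa using h))
    simp only [Matrix.of_apply, Fin.val_one]
    refine bandEntry_eq_zero fun s hs _ h => ?_
    have h2 := h.2.2 rfl
    dsimp only at h2
    omega

theorem bandMinor_irreducible {n k N : ℕ} (hn : k < n) (hm : 2 ≤ n - 1)
    (hN : ∀ r < N, r / (n - 1) + 1 < k) {L : ℕ} :
    ∀ {t : ℕ} {S : Set (ℕ × ℕ)}, t + (L + 1) = N →
      (∀ r, t ≤ r → r < N → (k - r / (n - 1), r % (n - 1) + 2) ∈ S) →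
      (∀ r, t ≤ r → r + 1 < N → (k - r / (n - 1) + 1, r % (n - 1) + 2) ∈ S) →
      (∀ r, t < r → r < N → (k - r / (n - 1) - 1, r % (n - 1) + 2) ∈ S) →
      Irreducible (bandMinor n k S t (L + 1)) := by
  induction L with
  | zero =>
    intro t S ht hd _ _
    have hqt := hN t (by omega)
    have : bandMinor n k S t 1 = MvPolynomial.X (k - t / (n - 1), t % (n - 1) + 2) := by
      rw [bandMinor, Matrix.det_fin_one]
      simp only [Matrix.of_apply, Fin.val_zero, add_zero]
      exact bandEntry_eq_X (by omega) (by omega) ((Nat.sub_le _ _).trans k.le_succ)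
        (hd t le_rfl (by omega))
    rw [zero_add, this]
    exact (MvPolynomial.X_prime).irreducible
  | succ L ih =>
    intro t S ht hd hsup hsub
    have hqt := hN t (by omega)
    let x : ℕ × ℕ := (k - t / (n - 1), t % (n - 1) + 2)
    let T : Set (ℕ × ℕ) :=
      {v | v.2 = t % (n - 1) + 2 → v.1 ≤ k + 1 → v.1 ≤ k - t / (n - 1)}
    have hxk : x.1 ≤ k + 1 := (Nat.sub_le _ _).trans (Nat.le_succ k)
    have hxT : x ∈ T := fun _ _ => le_rfl
    have hF' : restrictVars T (bandMinor n k S t (L + 2)) =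
        MvPolynomial.X x * bandMinor n k (S ∩ T) (t + 1) (L + 1) := by
      rw [restrictVars_bandMinor]
      exact bandMinor_succ (by omega) ⟨hd t le_rfl (by omega), hxT⟩
        fun s hs hsk h => absurd (h.2 rfl hsk) (not_le.mpr hs)
    have hirr : Irreducible (bandMinor n k (S ∩ T) (t + 1) (L + 1)) := by
      refine ih (by omega) (fun r hr hrN => ⟨hd r (by omega) hrN, fun h1 _ => ?_⟩)
        (fun r hr hrN => ⟨hsup r (by omega) hrN, fun h1 _ => ?_⟩)
        (fun r hr hrN => ⟨hsub r (by omega) hrN, fun h1 _ => ?_⟩) <;>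
      · have := hN r (by omega)
        have := div_lt_div_of_mod_eq (m := n - 1) (show t < r by omega) (by simpa using h1)
        dsimp only
        omega
    have hdiff : restrictVars {x}ᶜ (bandMinor n k S t (L + 2)) ≠ 0 := by
      rw [restrictVars_bandMinor]
      exact bandMinor_diff_ne_zero hm hN ht hd (hsup t le_rfl (by omega))
        (hsub (t + 1) (by omega) (by omega))
    have hF0 : bandMinor n k S t (L + 2) ≠ 0 := fun h => hdiff (by rw [h, map_zero])
    have hhom := bandMinor_isWeightedHomogeneous (n := n) (k := k) (by omega) S t (L + 2)
    have hw : ∀ v, n ≤ colWeight n k v := fun v => Nat.le_add_right _ _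
    have hx : colWeight n k x < 2 * n := by
      have := Nat.mod_lt (x.1 + x.2) (show n > 0 by omega)
      rw [colWeight, if_pos hxk]
      omega
    have hwx : ∀ v ∉ T, colWeight n k v ≠ colWeight n k x := by
      rintro ⟨s, i⟩ hv
      simp only [T, Set.mem_ofPred_eq, Classical.not_imp, not_le] at hv
      obtain ⟨rfl, hs, hs'⟩ := hv
      rw [colWeight, colWeight, if_pos hs, if_pos hxk]
      intro h
      have h' := (Nat.add_left_cancel h).symm
      have h'' := (Nat.modEq_iff_dvd' (show x.1 + x.2 ≤ s + (t % (n - 1) + 2) by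
        dsimp only [x]; omega)).mp h'
      have := Nat.le_of_dvd (by dsimp only [x]; omega) h''
      dsimp only [x] at this
      omega
    have hside : ∀ g h : Rband, bandMinor n k S t (L + 2) = g * h →
        MvPolynomial.X x ∣ restrictVars T g → IsUnit h := by
      intro g h hgh hdvd
      rw [hgh] at hhom hF0 hF' hdiff
      obtain ⟨e, hg⟩ := exists_isWeightedHomogeneous_of_mul hhom hF0
      rw [mul_comm] at hhom hF0
      obtain ⟨e', hh⟩ := exists_isWeightedHomogeneous_of_mul hhom hF0
      obtain ⟨u, hu⟩ := hdvd
      rw [map_mul, hu, mul_assoc] at hF'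
      have hF'' := mul_left_cancel₀ (MvPolynomial.X_ne_zero x) hF'
      rcases hirr.isUnit_or_isUnit hF''.symm with hunit | hunit
      · obtain ⟨y, hy⟩ := X_dvd_of_restrictVars_eq hw hxT hx hwx hg hunit hu
        refine absurd ?_ hdiff
        rw [hy, map_mul, map_mul, restrictVars_X_of_notMem (by simp), zero_mul, zero_mul]
      · exact isUnit_of_isUnit_restrictVars (fun v => by have := hw v; omega) hh hunit
    refine ⟨fun hu => ?_, fun g h hgh => ?_⟩
    · have := hu.map (restrictVars T)
      rw [hF'] at this
      exact hirr.not_isUnit (isUnit_of_mul_isUnit_right this)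
    · have hdvd : MvPolynomial.X x ∣ restrictVars T g * restrictVars T h :=
        ⟨_, by rw [← map_mul, ← hgh, hF']⟩
      rcases (MvPolynomial.X_prime (i := x)).dvd_or_dvd hdvd with h1 | h1
      · exact Or.inr (hside g h hgh h1)
      · exact Or.inl (hside h g (hgh.trans (mul_comm g h)) h1)

/-- in the generic band situation the trailing minors `φ̃_t`,
`1 ≤ t ≤ (k-1)(n-1)`, are irreducible. -/
theorem statement17 (n k : ℕ) (hk : 2 ≤ k) (hn : k < n) :
    ∀ t : ℕ, 1 ≤ t → t ≤ (k - 1) * (n - 1) →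
      Irreducible
        (sminor (stairCore n k (bandX n k genA) (bandY n k genA)) t
          ((k - 1) * (n - 1))) := by
  intro t ht htN
  have hn1 : 0 < n - 1 := by omega
  obtain ⟨L, hL⟩ : ∃ L, (k - 1) * (n - 1) + 1 - t = L + 1 :=
    ⟨(k - 1) * (n - 1) - t, by omega⟩
  have heq : sminor (stairCore n k (bandX n k genA) (bandY n k genA)) t ((k - 1) * (n - 1)) =
      bandMinor n k Set.univ (t - 1) (L + 1) := by
    rw [sminor, hL, bandMinor]
    congr 1
    ext1 i j
    exact stairCore_band_eq_bandEntry hk hn (by have := i.isLt; omega)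
  rw [heq]
  refine bandMinor_irreducible (N := (k - 1) * (n - 1)) hn (by omega) (fun r hr => ?_)
    (by omega) (fun _ _ _ => trivial) (fun _ _ _ => trivial) (fun _ _ _ => trivial)
  have := (Nat.div_lt_iff_lt_mul hn1).mpr hr
  omega

end
end
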